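/- Let C : f = 0 be a nearly free reduced plane curve of degree d with exponents (d1, d2), where d1 ≤ d2 and d1 + d2 = d. Then C is almost free if and only if d2 = d1 when d is even, and d2 = d1 + 1 when d is odd. -/

import Mathlib

open MvPolynomial

noncomputable section

/-- The polynomial ring `S = ℂ[x,y,z]`. -/
abbrev S : Type := MvPolynomial (Fin 3) ℂ

/-- The Jacobian ideal of `f`, spanned by the three partial derivatives. -/
def Jf (f : S) : Ideal S := Ideal.span {pderiv 0 f, pderiv 1 f, pderiv 2 f}

/-- The irrelevant maximal ideal `m = (x,y,z)`. -/
def mId : Ideal S := Ideal.span {X 0, X 1, X 2}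

/-- The saturation `I_f` of the Jacobian ideal with respect to `m`. -/
def Isat (f : S) : Ideal S := ⨆ n : ℕ, Submodule.colon (Jf f) ((mId ^ n : Ideal S) : Submodule S S)

/-- The quotient map `S → M(f) = S/J_f`, as a `ℂ`-linear map. -/
def quotC (f : S) : S →ₗ[ℂ] (S ⧸ (Jf f : Submodule S S)) :=
  ((Jf f : Submodule S S).mkQ).restrictScalars ℂ

/-- Degree-`k` homogeneous component of `S`, as a `ℂ`-subspace. -/
def Sgr (k : ℕ) : Submodule ℂ S := homogeneousSubmodule (Fin 3) ℂ k

/-- The degree-`k` part of the Milnor algebra `M(f)`. -/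
def Msub (f : S) (k : ℕ) : Submodule ℂ (S ⧸ (Jf f : Submodule S S)) := (Sgr k).map (quotC f)

/-- `m(f)_k`, the dimension of the degree-`k` part of the Milnor algebra. -/
def mdim (f : S) (k : ℕ) : ℕ := Module.finrank ℂ (Msub f k)

/-- The degree-`k` part of the Jacobian module `N(f) = I_f/J_f`, realized inside `S/J_f`. -/
def Nsub (f : S) (k : ℕ) : Submodule ℂ (S ⧸ (Jf f : Submodule S S)) :=
  (((Isat f).restrictScalars ℂ) ⊓ Sgr k).map (quotC f)

/-- `dim_ℂ N(f)_k`. -/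
def ndim (f : S) (k : ℕ) : ℕ := Module.finrank ℂ (Nsub f k)

/-- The Jacobian module `N(f) = I_f/J_f`, as an `S`-submodule of `S/J_f`. -/
def Nmod (f : S) : Submodule S (S ⧸ (Jf f : Submodule S S)) :=
  Submodule.map ((Jf f : Submodule S S).mkQ) (Isat f : Submodule S S)

/-- The Jacobian module `N(f)` as a `ℂ`-subspace of `S/J_f`. -/
def NsubTot (f : S) : Submodule ℂ (S ⧸ (Jf f : Submodule S S)) :=
  ((Isat f).restrictScalars ℂ).map (quotC f)

/-- `dim_ℂ N(f)`. -/
def ndimTot (f : S) : ℕ := Module.finrank ℂ (NsubTot f)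

/-- `C : f = 0` is nearly free: `N(f) ≠ 0` and `dim N(f)_k ≤ 1` for all `k`. -/
def NearlyFree (f : S) : Prop := Nmod f ≠ ⊥ ∧ ∀ k : ℕ, ndim f k ≤ 1

/-- `f` defines a union of lines passing through one point. -/
def IsConeOfLines (f : S) : Prop :=
  ∃ q : Fin 3 → ℂ, q ≠ 0 ∧ ∃ (c : ℂ) (L : Multiset S),
    (∀ l ∈ L, l ∈ Sgr 1 ∧ eval q l = 0) ∧ f = C c * L.prod

/-- The defining equation map `(a,b,c) ↦ a f_x + b f_y + c f_z`. -/
def eqnMap (f : S) : (Fin 3 → S) →ₗ[S] S where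
  toFun r := ∑ i, r i * pderiv i f
  map_add' a b := by simp [add_mul, Finset.sum_add_distrib]
  map_smul' c a := by simp [Finset.mul_sum, mul_assoc]

/-- `AR(f)`, the module of all relations among the partial derivatives of `f`. -/
def ARmod (f : S) : Submodule S (Fin 3 → S) := LinearMap.ker (eqnMap f)

/-- A triple of polynomials is homogeneous of degree `m` (componentwise). -/
def IsHomRel (r : Fin 3 → S) (m : ℕ) : Prop := ∀ i, r i ∈ Sgr m

/-- The set of degrees of nonzero homogeneous relations in `AR(f)`;
its least element is `mdr(f)`. -/
def mdrSet (f : S) : Set ℕ := {m | ∃ r ∈ ARmod f, r ≠ 0 ∧ IsHomRel r m}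

/-- The map `(u₁,u₂,u₃) ↦ u₁ r₁ + u₂ r₂ + u₃ r₃` whose kernel is the syzygy
module among `r₁, r₂, r₃`. -/
def syzMap (r : Fin 3 → (Fin 3 → S)) : (Fin 3 → S) →ₗ[S] (Fin 3 → S) where
  toFun u := ∑ j, u j • r j
  map_add' a b := by simp [add_smul, Finset.sum_add_distrib]
  map_smul' c a := by simp [Finset.smul_sum, smul_smul]

/-- `M(f)` has a minimal graded free resolution
`0 → S(−b−2(d−1)) → ⊕ᵢ S(−dᵢ−(d−1)) → S(−d+1)³ → S`; equivalently, `AR(f)` is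
generated by three homogeneous relations of degrees `d₁, d₂, d₃`, none lying in
the submodule spanned by the other two, whose syzygy module is free of rank one,
generated by a homogeneous triple `(v₁,v₂,v₃)` with `deg vᵢ = b − dᵢ + d − 1`. -/
def HasResolution (f : S) (d : ℕ) (dd : Fin 3 → ℕ) (b : ℤ) : Prop :=
  ∃ r : Fin 3 → (Fin 3 → S),
    (∀ j, r j ∈ ARmod f) ∧
    (∀ j, IsHomRel (r j) (dd j)) ∧
    Submodule.span S (Set.range r) = ARmod f ∧
    (∀ j, r j ∉ Submodule.span S (r '' {k | k ≠ j})) ∧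
    ∃ v : Fin 3 → S, v ≠ 0 ∧
      (∀ j, ∃ e : ℕ, (e : ℤ) = b - dd j + d - 1 ∧ v j ∈ Sgr e) ∧
      LinearMap.ker (syzMap r) = Submodule.span S {v}

/-- The Hilbert function of the Milnor algebra of a smooth plane curve of
degree `d`: the coefficient of `t^k` in `((1 − t^{d−1})/(1 − t))³`. -/
def msHilb (d k : ℕ) : ℕ :=
  (((∑ i ∈ Finset.range (d - 1), (Polynomial.X : Polynomial ℕ) ^ i)) ^ 3).coeff k

/-- `τ` is the total Tjurina number of `C : f = 0`, i.e. the common value of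
`m(f)_k` for all sufficiently large `k`. -/
def TjurinaIs (f : S) (τ : ℕ) : Prop := ∃ N : ℕ, ∀ k ≥ N, mdim f k = τ



abbrev hc (k : ℕ) : S →ₗ[ℂ] S := homogeneousComponent k

lemma hc_mul_aux {g : S} {D : ℕ} (hg : g.IsHomogeneous D) (v : S) (m : ℕ) :
    hc m (g * v) = if D ≤ m then g * hc (m - D) v else 0 := by
  have h1 : hc m (g * v) = ∑ i ∈ Finset.range (v.totalDegree + 1), hc m (g * hc i v) := by
    conv_lhs => rw [← sum_homogeneousComponent v, Finset.mul_sum, map_sum]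
  have h2 : ∀ i, hc m (g * hc i v) = if m = D + i then g * hc i v else 0 := fun i =>
    homogeneousComponent_of_mem (hg.mul (homogeneousComponent_isHomogeneous _ _))
  rw [h1]
  simp_rw [h2]
  split_ifs with h
  · obtain ⟨k, rfl⟩ := Nat.exists_eq_add_of_le h
    simp only [Nat.add_left_cancel_iff, Nat.add_sub_cancel_left]
    rw [Finset.sum_ite_eq]
    split_ifs with h3
    · rfl
    · rw [hc, homogeneousComponent_eq_zero, mul_zero]
      simp at h3; omega
  · apply Finset.sum_eq_zero
    intro i _
    rw [if_neg (by omega)]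

lemma hc_mul_hom' {g : S} {D : ℕ} (hg : g.IsHomogeneous D) (v : S) (k m : ℕ) (h : m = k + D) :
    hc m (g * v) = g * hc k v := by
  subst h
  rw [hc_mul_aux hg, if_pos (by omega), Nat.add_sub_cancel]

lemma hc_mul_hom {g : S} {D : ℕ} (hg : g.IsHomogeneous D) (v : S) (k : ℕ) :
    hc (k + D) (v * g) = hc k v * g := by
  rw [mul_comm, hc_mul_hom' hg v k _ rfl, mul_comm]

lemma hc_mul_hom_lt {g : S} {D : ℕ} (hg : g.IsHomogeneous D) (v : S) (k : ℕ) (h : k < D) :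
    hc k (g * v) = 0 := by
  rw [hc_mul_aux hg, if_neg (by omega)]

lemma hc_self {g : S} {D : ℕ} (hg : g.IsHomogeneous D) : hc D g = g :=
  homogeneousComponent_eq_self hg

lemma hc_hom (k : ℕ) (v : S) : (hc k v).IsHomogeneous k := homogeneousComponent_isHomogeneous _ _

lemma hom_of_mul {g v : S} {D k : ℕ} (hg : g.IsHomogeneous D) (hg0 : g ≠ 0)
    (h : (v * g).IsHomogeneous (k + D)) : v.IsHomogeneous k := by
  have := hc_mul_hom hg v k
  rw [hc_self h] at this
  have := mul_right_cancel₀ hg0 this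
  rw [this]; exact hc_hom _ _

/-! Saturation -/
lemma mem_Isat {f q : S} : q ∈ Isat f ↔ ∃ n : ℕ, ∀ s ∈ mId ^ n, q * s ∈ Jf f := by
  unfold Isat
  rw [Submodule.mem_iSup_of_directed]
  · simp [Submodule.mem_colon]
  · refine Monotone.directed_le ?_
    intro a b hab x hx
    rw [Submodule.mem_colon] at hx ⊢
    intro s hs
    exact hx s (Ideal.pow_le_pow_right hab hs)

lemma X_mem_mId (i : Fin 3) : (X i : S) ∈ mId := by
  apply Ideal.subset_span; fin_cases i <;> simp

lemma Jf_le_Isat (f : S) : Jf f ≤ Isat f := by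
  intro q hq
  rw [mem_Isat]
  exact ⟨0, fun s _ => Ideal.mul_mem_right _ _ hq⟩

lemma Isat_step {f q : S} (h : ∀ i, X i * q ∈ Isat f) : q ∈ Isat f := by
  have h' : ∀ i, ∃ n : ℕ, ∀ s ∈ mId ^ n, X i * q * s ∈ Jf f := fun i => mem_Isat.1 (h i)
  choose n hn using h'
  rw [mem_Isat]
  refine ⟨n 0 + n 1 + n 2 + 1, ?_⟩
  intro s hs
  rw [pow_succ] at hs
  refine Submodule.mul_induction_on hs ?_ ?_
  · intro a ha b hb
    have key : ∀ i, a * X i * q ∈ Jf f := by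
      intro i
      have : a ∈ mId ^ (n i) := Ideal.pow_le_pow_right (by fin_cases i <;> simp <;> omega) ha
      have := hn i a this
      convert this using 1; ring
    rw [mId, Ideal.mem_span_insert] at hb
    obtain ⟨x, z, hz, rfl⟩ := hb
    rw [Ideal.mem_span_pair] at hz
    obtain ⟨y, w, rfl⟩ := hz
    have : q * (a * (x * X 0 + (y * X 1 + w * X 2))) =
      x * (a * X 0 * q) + (y * (a * X 1 * q) + w * (a * X 2 * q)) := by ring
    rw [this]
    exact add_mem (Ideal.mul_mem_left _ _ (key 0))
      (add_mem (Ideal.mul_mem_left _ _ (key 1)) (Ideal.mul_mem_left _ _ (key 2)))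
  · intro x y hx hy
    rw [mul_add]; exact add_mem hx hy

lemma Isat_le {f : S} {J' : Ideal S} (hJ : Jf f ≤ J')
    (h : ∀ q, (∀ i, X i * q ∈ J') → q ∈ J') : Isat f ≤ J' := by
  intro q hq
  obtain ⟨n, hn⟩ := mem_Isat.1 hq
  replace hn : ∀ s ∈ mId ^ n, q * s ∈ J' := fun s hs => hJ (hn s hs)
  induction n with
  | zero => simpa using hn 1 (by simp)
  | succ n ih =>
    apply ih
    intro s hs
    apply h
    intro i
    have := hn (s * X i) (by rw [pow_succ]; exact Ideal.mul_mem_mul hs (X_mem_mId i))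
    convert this using 1; ring

lemma desc (J' : Ideal S) (h : ∀ q, (∀ i, X i * q ∈ J') → q ∈ J') (q : S) (k : ℕ)
    (hk : ∀ s : S, s.IsHomogeneous k → s * q ∈ J') : q ∈ J' := by
  induction k with
  | zero => simpa using hk 1 (isHomogeneous_one _ _)
  | succ k ih =>
    apply ih
    intro s hs
    apply h
    intro i
    have := hk (X i * s) (by rw [add_comm]; exact (isHomogeneous_X _ i).mul hs)
    rwa [mul_assoc] at this

/-! Restriction to a line -/
def phi (p : Fin 3 → ℂ) : S →ₐ[ℂ] Polynomial ℂ := aeval fun i => Polynomial.C (p i) * Polynomial.X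

def lin (a : Fin 3 → ℂ) : S := ∑ i, C (a i) * X i

lemma lin_hom (a : Fin 3 → ℂ) : (lin a).IsHomogeneous 1 :=
  IsHomogeneous.sum _ _ _ fun i _ => isHomogeneous_C_mul_X _ _

lemma phi_hom (p : Fin 3 → ℂ) {s : S} {k : ℕ} (hs : s.IsHomogeneous k) :
    phi p s = Polynomial.C (eval p s) * Polynomial.X ^ k := by
  rw [s.as_sum, map_sum, map_sum, map_sum, Finset.sum_mul]
  refine Finset.sum_congr rfl fun m hm => ?_
  have hk : m.degree = k := by
    by_contra hne
    exact (mem_support_iff.1 hm) (hs.coeff_eq_zero hne)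
  subst hk
  simp [phi, aeval_monomial, eval_monomial, Finsupp.prod_fintype, Finsupp.degree_eq_sum, mul_pow,
    Fin.prod_univ_three, Fin.sum_univ_three, pow_add]
  ring

lemma eval_lin (p a : Fin 3 → ℂ) : eval p (lin a) = ∑ i, a i * p i := by
  simp [lin]

lemma ker_phi (a b : Fin 3 → ℂ) (p : Fin 3 → ℂ)
    (hp : p = ![a 1 * b 2 - a 2 * b 1, a 2 * b 0 - a 0 * b 2, a 0 * b 1 - a 1 * b 0])
    (hp0 : p ≠ 0) (q : S) : phi p q = 0 ↔ ∃ x y, q = x * lin a + y * lin b := by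
  have h0 : phi p (lin a) = 0 := by
    rw [phi_hom p (lin_hom a), eval_lin, hp]; simp [Fin.sum_univ_three]; ring
  have h1 : phi p (lin b) = 0 := by
    rw [phi_hom p (lin_hom b), eval_lin, hp]; simp [Fin.sum_univ_three]; ring
  constructor
  · intro hq
    obtain ⟨k, hk⟩ : ∃ k, p k ≠ 0 := by
      by_contra h; push Not at h; exact hp0 (funext h)
    set t : S := C (p k)⁻¹ * X k
    have key : ∀ q : S, q - Polynomial.aeval t (phi p q) ∈ Ideal.span {lin a, lin b} := by
      intro q
      rw [← Ideal.Quotient.mk_eq_mk_iff_sub_mem]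
      have : (Ideal.Quotient.mkₐ ℂ (Ideal.span {lin a, lin b})) =
        (Ideal.Quotient.mkₐ ℂ (Ideal.span {lin a, lin b})).comp
          ((Polynomial.aeval t).comp (phi p)) := by
        apply MvPolynomial.algHom_ext
        intro i
        simp only [Ideal.Quotient.mkₐ_eq_mk, AlgHom.comp_apply]
        rw [Ideal.Quotient.mk_eq_mk_iff_sub_mem, Ideal.mem_span_pair]
        have e1 : Polynomial.aeval t (phi p (X i)) = C (p i) * t := by
          simp [phi, MvPolynomial.algebraMap_eq]
        rw [e1]
        have hC : (C (p k) : S) * C (p k)⁻¹ = 1 := by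
          rw [← C_mul, mul_inv_cancel₀ hk, C_1]
        have hpk : ∀ z : S, C (p k) * (C (p k)⁻¹ * z) = z := by
          intro z; rw [← mul_assoc, hC, one_mul]
        -- p k * X i - p i * X k is a combination
        have : ∃ x y : S, x * lin a + y * lin b = C (p k) * X i - C (p i) * X k := by
          simp only [lin, Fin.sum_univ_three, hp]
          fin_cases i <;> fin_cases k
          · exact ⟨0, 0, by simp⟩
          · exact ⟨-C (b 2), C (a 2), by simp; ring⟩
          · exact ⟨C (b 1), -C (a 1), by simp; ring⟩
          · exact ⟨C (b 2), -C (a 2), by simp; ring⟩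
          · exact ⟨0, 0, by simp⟩
          · exact ⟨-C (b 0), C (a 0), by simp; ring⟩
          · exact ⟨-C (b 1), C (a 1), by simp; ring⟩
          · exact ⟨C (b 0), -C (a 0), by simp; ring⟩
          · exact ⟨0, 0, by simp⟩
        obtain ⟨x, y, hxy⟩ := this
        refine ⟨C (p k)⁻¹ * x, C (p k)⁻¹ * y, ?_⟩
        simp only [t]
        linear_combination C (p k)⁻¹ * hxy + X i * hC
      exact DFunLike.congr_fun this q
    have := key q
    rw [hq, map_zero, sub_zero, Ideal.mem_span_pair] at this
    obtain ⟨x, y, h⟩ := this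
    exact ⟨x, y, h.symm⟩
  · rintro ⟨x, y, rfl⟩
    simp [h0, h1]

lemma X_reg (a : S) (h : ∃ x y : S, X 2 * a = x * X 0 + y * X 1) :
    ∃ x y : S, a = x * X 0 + y * X 1 := by
  have hk := ker_phi ![1, 0, 0] ![0, 1, 0] ![0, 0, 1] (by simp) (by intro h; simpa using congrFun h 2)
  have l0 : lin ![1, 0, 0] = X 0 := by simp [lin, Fin.sum_univ_three]
  have l1 : lin ![0, 1, 0] = X 1 := by simp [lin, Fin.sum_univ_three]
  rw [l0, l1] at hk
  rw [← hk] at h ⊢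
  rw [map_mul] at h
  refine (mul_eq_zero.1 h).resolve_left ?_
  simp [phi]


def dt (a b : Fin 3 → S) : S := a 0 * b 0 + a 1 * b 1 + a 2 * b 2
def cr (a b : Fin 3 → S) : Fin 3 → S :=
  ![a 1 * b 2 - a 2 * b 1, a 2 * b 0 - a 0 * b 2, a 0 * b 1 - a 1 * b 0]

lemma cr_0 (a b : Fin 3 → S) : cr a b 0 = a 1 * b 2 - a 2 * b 1 := rfl
lemma cr_1 (a b : Fin 3 → S) : cr a b 1 = a 2 * b 0 - a 0 * b 2 := rfl
lemma cr_2 (a b : Fin 3 → S) : cr a b 2 = a 0 * b 1 - a 1 * b 0 := rfl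

def CT (r : Fin 3 → S) : Prop := ∀ u w : S, (∀ i, u ∣ r i * w) → u ∣ w

lemma CT_of {r : Fin 3 → S} (h : ∀ p : S, Irreducible p → ¬ ∀ i, p ∣ r i) : CT r := by
  letI : GCDMonoid S := UniqueFactorizationMonoid.toGCDMonoid S
  have hG : IsUnit (gcd (r 0) (gcd (r 1) (r 2))) := by
    have hd : ∀ i, gcd (r 0) (gcd (r 1) (r 2)) ∣ r i := by
      intro i
      fin_cases i
      · exact gcd_dvd_left _ _
      · exact (gcd_dvd_right _ _).trans (gcd_dvd_left _ _)
      · exact (gcd_dvd_right _ _).trans (gcd_dvd_right _ _)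
    by_contra hu
    by_cases h0 : gcd (r 0) (gcd (r 1) (r 2)) = 0
    · have := (X_prime (R := ℂ) (i := (0 : Fin 3))).irreducible
      refine h _ this fun i => ?_
      have := hd i
      rw [h0, zero_dvd_iff] at this
      rw [this]; exact dvd_zero _
    · obtain ⟨p, hp, hpd⟩ := WfDvdMonoid.exists_irreducible_factor hu h0
      exact h p hp fun i => hpd.trans (hd i)
  intro u w hu
  have h1 : u ∣ gcd (r 0) (gcd (r 1) (r 2)) * w := by
    have e1 : Associated (gcd (r 0 * w) (gcd (r 1 * w) (r 2 * w)))
        (gcd (r 0) (gcd (r 1) (r 2)) * w) :=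
      (Associated.gcd (Associated.refl _) (gcd_mul_right' _ _ _)).trans (gcd_mul_right' _ _ _)
    exact (dvd_gcd (hu 0) (dvd_gcd (hu 1) (hu 2))).trans e1.dvd
  exact (hG.dvd_mul_left).1 h1

lemma CT_ne {g : Fin 3 → S} (hg : CT g) : ∃ i, g i ≠ 0 := by
  by_contra h
  push Not at h
  have := hg (X 0) 1 (by simp [h])
  exact (X_prime (R := ℂ) (i := (0 : Fin 3))).not_isUnit (isUnit_of_dvd_one this)

lemma CT_cancel {g : Fin 3 → S} (hg : CT g) {k : S} (h : ∀ i, k * g i = 0) : k = 0 := by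
  obtain ⟨i, hi⟩ := CT_ne hg
  exact (mul_eq_zero.1 (h i)).resolve_right hi

lemma parallel {g z : Fin 3 → S} (hg : CT g) (h : ∀ i j, z i * g j = z j * g i) :
    ∃ k : S, ∀ i, z i = k * g i := by
  obtain ⟨i, hi⟩ := CT_ne hg
  obtain ⟨k, hk⟩ : g i ∣ z i := by
    apply hg
    intro j
    exact ⟨z j, by rw [mul_comm, h i j, mul_comm]⟩
  refine ⟨k, fun j => ?_⟩
  have := h i j
  rw [hk] at this
  apply mul_right_cancel₀ hi
  rw [← this]; ring

lemma parallel_cr {g z : Fin 3 → S} (hg : CT g) (h : cr g z = 0) :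
    ∃ k : S, ∀ i, z i = k * g i := by
  apply parallel hg
  have h0 := congrFun h 0
  have h1 := congrFun h 1
  have h2 := congrFun h 2
  simp only [cr_0, cr_1, cr_2, Pi.zero_apply] at h0 h1 h2
  intro i j
  fin_cases i <;> fin_cases j <;> simp <;>
    first | linear_combination h0 | linear_combination h1 | linear_combination h2 |
      linear_combination -h0 | linear_combination -h1 | linear_combination -h2

lemma delta {g r s : Fin 3 → S} (hg : CT g) (hr : dt r g = 0) (hs : dt s g = 0) :
    ∃ k : S, ∀ i, cr r s i = k * g i := by
  apply parallel_cr hg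
  simp only [dt] at hr hs
  funext i
  fin_cases i
  · simp [cr]; linear_combination r 0 * hs - s 0 * hr
  · simp [cr]; linear_combination r 1 * hs - s 1 * hr
  · simp [cr]; linear_combination r 2 * hs - s 2 * hr

lemma K2 {p1 p2 p3 : S} (h0 : p1 ≠ 0) (h12 : ∀ a, p1 ∣ p2 * a → p1 ∣ a)
    (h3 : ∀ a, (∃ x y, p3 * a = x * p1 + y * p2) → ∃ x y, a = x * p1 + y * p2)
    (a1 a2 a3 : S) (h : p1 * a1 + p2 * a2 + p3 * a3 = 0) :
    ∃ x y z, a1 = -(p3 * x) - p2 * z ∧ a2 = -(p3 * y) + p1 * z ∧ a3 = p1 * x + p2 * y := by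
  obtain ⟨x, y, hxy⟩ := h3 a3 ⟨-a1, -a2, by linear_combination h⟩
  subst hxy
  obtain ⟨z, hz⟩ := h12 (a2 + p3 * y) ⟨-a1 - p3 * x, by linear_combination h⟩
  refine ⟨x, y, z, ?_, by linear_combination hz, by ring⟩
  apply mul_left_cancel₀ h0
  linear_combination h - p2 * hz

lemma K2v {p1 p2 p3 : S} (h0 : p1 ≠ 0) (h12 : ∀ a, p1 ∣ p2 * a → p1 ∣ a)
    (h3 : ∀ a, (∃ x y, p3 * a = x * p1 + y * p2) → ∃ x y, a = x * p1 + y * p2)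
    (a1 a2 a3 : Fin 3 → S) (h : ∀ i, p1 * a1 i + p2 * a2 i + p3 * a3 i = 0) :
    ∃ x y z : Fin 3 → S, ∀ i, a1 i = -(p3 * x i) - p2 * z i ∧ a2 i = -(p3 * y i) + p1 * z i ∧
      a3 i = p1 * x i + p2 * y i := by
  choose x y z hh using fun i => K2 h0 h12 h3 (a1 i) (a2 i) (a3 i) (h i)
  exact ⟨x, y, z, hh⟩

def D2 (F : Type) [AddCommGroup F] [Module S F] : Prop :=
  ∀ a b : F, (X 1 : S) • a = (X 0 : S) • b → ∃ c, a = (X 0 : S) • c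

lemma D2_S (a b : S) (h : X 1 * a = X 0 * b) : ∃ c, a = X 0 * c := by
  have hp := X_prime (R := ℂ) (i := (0 : Fin 3))
  refine (hp.dvd_or_dvd ⟨b, h⟩).resolve_left ?_
  rw [X_dvd_X]; decide

lemma D2_prod {F G : Type} [AddCommGroup F] [Module S F] [AddCommGroup G] [Module S G]
    (hF : D2 F) (hG : D2 G) : D2 (F × G) := by
  intro a b h
  obtain ⟨c, hc⟩ := hF a.1 b.1 (congrArg Prod.fst h)
  obtain ⟨e, he⟩ := hG a.2 b.2 (congrArg Prod.snd h)
  exact ⟨(c, e), Prod.ext hc he⟩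

lemma D2_self : D2 S := fun a b h => D2_S a b h

lemma D2_pi : D2 (Fin 3 → S) := by
  intro a b h
  choose c hc using fun i => D2_S (a i) (b i) (congrFun h i)
  exact ⟨c, funext hc⟩

lemma sat {F : Type} [AddCommGroup F] [Module S F] (hF : D2 F) (φ : F →ₗ[S] S) {n : ℕ}
    (ψ : (Fin n → S) →ₗ[S] F) (hinj : ∀ a, ψ a = 0 → a = 0) (hz : ∀ a, φ (ψ a) = 0)
    (hex : ∀ A, φ A = 0 → ∃ a, ψ a = A) (w : S) (h : ∀ i, ∃ A, φ A = X i * w) :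
    ∃ A, φ A = w := by
  obtain ⟨A, hA⟩ := h 0
  obtain ⟨B, hB⟩ := h 1
  obtain ⟨D, hD⟩ := h 2
  obtain ⟨a, ha⟩ := hex ((X 1 : S) • A - (X 0 : S) • B) (by
    simp only [map_sub, map_smul, hA, hB, smul_eq_mul]; ring)
  obtain ⟨b, hb⟩ := hex ((X 2 : S) • B - (X 1 : S) • D) (by
    simp only [map_sub, map_smul, hD, hB, smul_eq_mul]; ring)
  obtain ⟨c, hc⟩ := hex ((X 0 : S) • D - (X 2 : S) • A) (by
    simp only [map_sub, map_smul, hD, hA, smul_eq_mul]; ring)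
  have h0 : (X 2 : S) • a + (X 0 : S) • b + (X 1 : S) • c = 0 := by
    apply hinj
    simp only [map_add, map_smul, ha, hb, hc]
    module
  choose p q hpq using fun i => X_reg (a i) ⟨-b i, -c i, by
    have := congrFun h0 i
    simp only [Pi.add_apply, Pi.smul_apply, smul_eq_mul, Pi.zero_apply] at this
    linear_combination this⟩
  have hpq' : a = (X 0 : S) • p + (X 1 : S) • q := by
    funext i
    rw [hpq i]; simp; ring
  obtain ⟨e, he⟩ := hF (A - ψ q) (B + ψ p) (by
    rw [hpq', map_add, map_smul, map_smul] at ha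
    rw [smul_sub, smul_add, sub_eq_iff_eq_add]
    rw [eq_sub_iff_add_eq] at ha
    rw [← ha]; abel)
  refine ⟨e, ?_⟩
  have h1 : φ (A - ψ q) = X 0 * φ e := by rw [he, map_smul, smul_eq_mul]
  rw [map_sub, hz, sub_zero, hA] at h1
  exact (mul_left_cancel₀ (X_ne_zero 0) h1).symm

lemma exists_nzd (I : Ideal S) (r : Fin 3 → S) (h : ∀ w, (∀ i, r i * w ∈ I) → w ∈ I) :
    ∃ c : Fin 3 → ℂ, ∀ w, (∑ i, C (c i) * r i) * w ∈ I → w ∈ I := by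
  classical
  let L : (Fin 3 → ℂ) →ₗ[ℂ] S := ∑ i, (LinearMap.proj i).smulRight (r i)
  have hL : ∀ c, L c = ∑ i, C (c i) * r i := by
    intro c; simp [L, LinearMap.sum_apply, smul_eq_C_mul]
  have hfin := associatedPrimes.finite S (S ⧸ I)
  let s : Finset (Subspace ℂ (Fin 3 → ℂ)) :=
    hfin.toFinset.image fun P => (P.restrictScalars ℂ).comap L
  have hs : ⊤ ∉ s := by
    intro ht
    simp only [s, Finset.mem_image, Set.Finite.mem_toFinset] at ht
    obtain ⟨P, hP, hPt⟩ := ht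
    rw [AssociatedPrimes.mem_iff, isAssociatedPrime_iff] at hP
    obtain ⟨hpr, x, hx⟩ := hP
    obtain ⟨w, rfl⟩ := Ideal.Quotient.mk_surjective x
    have hmem : ∀ a, a ∈ P ↔ a * w ∈ I := by
      intro a
      rw [hx, Submodule.mem_colon_singleton, Submodule.mem_bot, ← Ideal.Quotient.eq_zero_iff_mem,
        map_mul]
      rfl
    have hw : w ∈ I := by
      apply h
      intro i
      rw [← hmem]
      have : Pi.single i 1 ∈ (P.restrictScalars ℂ).comap L := by rw [hPt]; trivial
      rw [Submodule.mem_comap, hL] at this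
      have e : ∑ j, C ((Pi.single i 1 : Fin 3 → ℂ) j) * r j = r i := by
        rw [Finset.sum_eq_single i]
        · simp
        · intro j _ hj; simp [hj]
        · simp
      rw [e] at this
      exact this
    exact hpr.ne_top ((Ideal.eq_top_iff_one _).2 ((hmem 1).2 (by simpa using hw)))
  have := Subspace.biUnion_ne_univ_of_top_notMem hs
  obtain ⟨c, hc⟩ := (Set.ne_univ_iff_exists_notMem _).1 this
  refine ⟨c, fun w hw => ?_⟩
  by_contra hwI
  apply hc
  have hz : L c ∈ ⋃ p ∈ associatedPrimes S (S ⧸ I), (p : Set S) := by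
    rw [biUnion_associatedPrimes_eq_zero_divisors]
    refine ⟨Ideal.Quotient.mk I w, ?_, ?_⟩
    · rwa [Ne, Ideal.Quotient.eq_zero_iff_mem]
    · rw [hL]
      have : (∑ i, C (c i) * r i) • (Ideal.Quotient.mk I w) =
        Ideal.Quotient.mk I ((∑ i, C (c i) * r i) * w) := by rw [map_mul]; rfl
      rw [this, Ideal.Quotient.eq_zero_iff_mem]; exact hw
  simp only [Set.mem_iUnion] at hz ⊢
  obtain ⟨P, hP, hLP⟩ := hz
  exact ⟨(P.restrictScalars ℂ).comap L, by
    simp only [s, Finset.mem_image, Set.Finite.mem_toFinset]; exact ⟨P, hP, rfl⟩, hLP⟩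

lemma sat_pair {u u' : S} (h0 : u ≠ 0) (h12 : ∀ a, u ∣ u' * a → u ∣ a) (w : S)
    (h : ∀ i, X i * w ∈ Ideal.span {u, u'}) : w ∈ Ideal.span {u, u'} := by
  simp only [Ideal.mem_span_pair] at h ⊢
  let φ : S × S →ₗ[S] S := (LinearMap.fst S S S).smulRight u + (LinearMap.snd S S S).smulRight u'
  let ψ : (Fin 1 → S) →ₗ[S] S × S :=
    LinearMap.prod ((LinearMap.proj 0).smulRight u') ((LinearMap.proj 0).smulRight (-u))
  have hφ : ∀ A, φ A = A.1 * u + A.2 * u' := fun A => by simp [φ]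
  have hψ : ∀ a, ψ a = (a 0 * u', a 0 * (-u)) := fun A => by simp [ψ]
  suffices key : ∃ A, φ A = w by
    obtain ⟨A, hA⟩ := key
    exact ⟨A.1, A.2, by rw [← hφ, hA]⟩
  refine sat (D2_prod D2_self D2_self) φ ψ ?_ ?_ ?_ w ?_
  · intro a ha
    rw [hψ] at ha
    have := congrArg Prod.snd ha
    simp only [Prod.snd_zero] at this
    funext i; fin_cases i
    exact (mul_eq_zero.1 this).resolve_right (neg_ne_zero.2 h0)
  · intro a; rw [hψ, hφ]; ring
  · rintro ⟨a, b⟩ hA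
    rw [hφ] at hA
    obtain ⟨k, hk⟩ := h12 b ⟨-a, by simp at hA; linear_combination hA⟩
    refine ⟨fun _ => -k, ?_⟩
    rw [hψ]
    simp only at hA
    ext1
    · simp only
      apply mul_right_cancel₀ h0
      rw [hk] at hA
      linear_combination -hA
    · simp only; rw [hk]; ring
  · intro i
    obtain ⟨a, b, hab⟩ := h i
    exact ⟨(a, b), by rw [hφ, ← hab]⟩


instance (k : ℕ) : FiniteDimensional ℂ (Sgr k) :=
  Module.Finite.iff_fg.2 (homogeneousSubmodule_fg (Fin 3) ℂ k)

lemma finrank_Sgr (k : ℕ) : Module.finrank ℂ (Sgr k) = Nat.choose (k + 2) 2 := by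
  unfold Sgr
  rw [homogeneousSubmodule_eq_finsupp_supported,
    (AddMonoidAlgebra.supportedEquivFinsupp (R := ℂ) (S := ℂ)
      {d : Fin 3 →₀ ℕ | d.degree = k}).finrank_eq]
  have e : {d : Fin 3 →₀ ℕ | d.degree = k} =
      ((Finset.univ : Finset (Fin 3)).finsuppAntidiag k : Finset (Fin 3 →₀ ℕ)) := by
    ext d
    simp [Finsupp.degree_eq_sum]
  rw [e]
  rw [Module.finrank_finsupp_self]
  simp only [Finset.coe_sort_coe, Fintype.card_coe]
  rw [Finset.card_finsuppAntidiag_nat_eq_choose]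
  simp only [Finset.card_univ, Fintype.card_fin]
  have : 3 + k - 1 = k + 2 := by omega
  rw [this]
  exact (Nat.choose_symm_add).symm ▸ rfl

def VV (k : ℤ) : Submodule ℂ S := if 0 ≤ k then Sgr k.toNat else ⊥

lemma VV_nat (n : ℕ) : VV (n : ℤ) = Sgr n := by
  unfold VV; rw [if_pos (by omega)]; simp

lemma VV_neg {k : ℤ} (h : ¬ 0 ≤ k) : VV k = ⊥ := by
  unfold VV; rw [if_neg h]

instance (k : ℤ) : FiniteDimensional ℂ (VV k) := by
  by_cases h : 0 ≤ k
  · obtain ⟨n, rfl⟩ := Int.eq_ofNat_of_zero_le h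
    rw [VV_nat]; infer_instance
  · rw [VV_neg h]; infer_instance

lemma finrank_VV (k : ℤ) (hk : -2 ≤ k) : 2 * (Module.finrank ℂ (VV k) : ℤ) = (k + 1) * (k + 2) := by
  by_cases h : 0 ≤ k
  · obtain ⟨n, rfl⟩ := Int.eq_ofNat_of_zero_le h
    rw [VV_nat, finrank_Sgr, Nat.choose_two_right]
    have h2 : 2 ∣ (n + 2) * (n + 2 - 1) := (Nat.even_mul_pred_self (n + 2)).two_dvd
    have h3 := Nat.mul_div_cancel' h2
    have h4 : ((2 * ((n + 2) * (n + 2 - 1) / 2) : ℕ) : ℤ) = ((n + 2) * (n + 1) : ℕ) := by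
      rw [h3]; rfl
    push_cast at h4 ⊢
    linarith
  · rw [VV_neg h, finrank_bot]
    obtain rfl | rfl : k = -1 ∨ k = -2 := by omega
    all_goals simp

lemma mem_VV_nat {k : ℕ} {p : S} : p ∈ VV k ↔ p.IsHomogeneous k := by
  simp [VV, Sgr]

def HomI (I : Ideal S) : Prop := ∀ p ∈ I, ∀ k, hc k p ∈ I

def hf (I : Ideal S) (k : ℤ) : ℕ := Module.finrank ℂ ↥((I.restrictScalars ℂ) ⊓ VV k)

lemma mul_VV {τ p : S} {m : ℕ} (hτ : τ.IsHomogeneous m) {k : ℤ} (hp : p ∈ VV (k - m)) :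
    τ * p ∈ VV k := by
  unfold VV at hp ⊢
  split_ifs at hp with h
  · rw [if_pos (by omega)]
    have : k.toNat = m + (k - m).toNat := by omega
    rw [this]
    exact IsHomogeneous.mul hτ hp
  · rw [Submodule.mem_bot] at hp
    subst hp
    simp

lemma HomI_sup {I : Ideal S} (hI : HomI I) {τ : S} {m : ℕ} (hτ : τ.IsHomogeneous m) :
    HomI (I ⊔ Ideal.span {τ}) := by
  intro p hp k
  obtain ⟨i, hi, j, hj, rfl⟩ := Submodule.mem_sup.1 hp
  obtain ⟨q, rfl⟩ := Ideal.mem_span_singleton.1 hj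
  rw [map_add]
  refine add_mem (Ideal.mem_sup_left (hI _ hi k)) (Ideal.mem_sup_right ?_)
  rw [hc_mul_aux hτ]
  split_ifs
  · exact Ideal.mul_mem_right _ _ (Ideal.mem_span_singleton_self _)
  · exact zero_mem _

lemma hf_sup {I : Ideal S} (hI : HomI I) {τ : S} {m : ℕ} (hτ : τ.IsHomogeneous m)
    (hn : ∀ q, τ * q ∈ I → q ∈ I) (h0 : τ ≠ 0) (k : ℤ) :
    (hf (I ⊔ Ideal.span {τ}) k : ℤ) = hf I k + Module.finrank ℂ (VV (k - m)) - hf I (k - m) := by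
  set A := (I.restrictScalars ℂ) ⊓ VV k with hA
  set W := VV (k - m) with hW
  let M : S →ₗ[ℂ] S := LinearMap.mulLeft ℂ τ
  have hMinj : Function.Injective M := fun a b h => mul_left_cancel₀ h0 h
  have e1 : ((I ⊔ Ideal.span {τ}).restrictScalars ℂ) ⊓ VV k = A ⊔ W.map M := by
    apply le_antisymm
    · rintro p ⟨hp, hpk⟩
      obtain ⟨i, hi, j, hj, rfl⟩ := Submodule.mem_sup.1 hp
      obtain ⟨q, rfl⟩ := Ideal.mem_span_singleton.1 hj
      by_cases hk : 0 ≤ k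
      · obtain ⟨n, rfl⟩ := Int.eq_ofNat_of_zero_le hk
        have h1 := hc_self (mem_VV_nat.1 hpk)
        rw [map_add] at h1
        rw [← h1]
        refine add_mem (Submodule.mem_sup_left ⟨hI _ hi _, mem_VV_nat.2 (hc_hom _ _)⟩) ?_
        rw [hc_mul_aux hτ]
        split_ifs with hmn
        · refine Submodule.mem_sup_right ⟨hc (n - m) q, ?_, rfl⟩
          have : (n : ℤ) - m = ((n - m : ℕ) : ℤ) := by omega
          rw [hW, this]
          exact mem_VV_nat.2 (hc_hom _ _)
        · exact zero_mem _
      · have hz : i + τ * q = 0 := by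
          simpa [VV, hk] using hpk
        rw [hz]; exact zero_mem _
    · refine sup_le (fun p hp => ⟨Ideal.mem_sup_left hp.1, hp.2⟩) ?_
      rintro _ ⟨q, hq, rfl⟩
      exact ⟨Ideal.mem_sup_right (Ideal.mul_mem_right _ _ (Ideal.mem_span_singleton_self _)),
        mul_VV hτ hq⟩
  have e2 : A ⊓ W.map M = ((I.restrictScalars ℂ) ⊓ W).map M := by
    apply le_antisymm
    · rintro _ ⟨⟨hi, _⟩, q, hq, rfl⟩
      exact ⟨q, ⟨hn q hi, hq⟩, rfl⟩
    · rintro _ ⟨q, ⟨hq, hq'⟩, rfl⟩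
      exact ⟨⟨Ideal.mul_mem_left _ _ hq, mul_VV hτ hq'⟩, q, hq', rfl⟩
  have e3 := Submodule.finrank_sup_add_finrank_inf_eq A (W.map M)
  have e4 := (Submodule.equivMapOfInjective M hMinj W).finrank_eq
  have e5 := (Submodule.equivMapOfInjective M hMinj ((I.restrictScalars ℂ) ⊓ W)).finrank_eq
  rw [e2, ← e1, ← e4, ← e5] at e3
  unfold hf
  rw [← hA, ← hW]
  omega

lemma hf_bot (k : ℤ) : hf ⊥ k = 0 := by
  unfold hf
  rw [Submodule.finrank_eq_zero]
  simp

/-- three homogeneous regular elements contain everything in high degree -/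
lemma TT {u u' τ : S} {e m : ℕ} (hu : u.IsHomogeneous e) (hu' : u'.IsHomogeneous e)
    (hτ : τ.IsHomogeneous m) (h0 : u ≠ 0) (h0' : u' ≠ 0) (h0τ : τ ≠ 0)
    (h12 : ∀ a, u ∣ u' * a → u ∣ a)
    (h3 : ∀ a, τ * a ∈ Ideal.span {u, u'} → a ∈ Ideal.span {u, u'}) (k : ℕ)
    (hk : e + e + m ≤ k + 2) (s : S) (hs : s.IsHomogeneous k) :
    ∃ x y z, s = x * u + y * u' + z * τ := by
  have b0 : HomI ⊥ := by
    intro p hp k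
    rw [Submodule.mem_bot] at hp
    rw [hp, map_zero]; exact zero_mem _
  have b1 : HomI (⊥ ⊔ Ideal.span {u}) := HomI_sup b0 hu
  have b2 : HomI (⊥ ⊔ Ideal.span {u} ⊔ Ideal.span {u'}) := HomI_sup b1 hu'
  have c1 := hf_sup b0 hu (by
    intro q hq
    rw [Submodule.mem_bot] at hq ⊢
    exact (mul_eq_zero.1 hq).resolve_left h0) h0
  have c2 := hf_sup b1 hu' (by
    intro q hq
    rw [bot_sup_eq, Ideal.mem_span_singleton] at hq ⊢
    exact h12 q hq) h0'
  have eI : ⊥ ⊔ Ideal.span {u} ⊔ Ideal.span {u'} = Ideal.span {u, u'} := by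
    rw [bot_sup_eq, ← Ideal.span_insert]
  have c3 := hf_sup b2 hτ (by rw [eI]; exact h3) h0τ k
  simp only [c2, c1, hf_bot] at c3
  have F := finrank_VV
  have f0 := F k (by omega)
  have f1 := F (k - e) (by omega)
  have f2 := F (k - e - e) (by omega)
  have f3 := F (k - m) (by omega)
  have f4 := F (k - m - e) (by omega)
  have f5 := F (k - m - e - e) (by omega)
  have hle : ((⊥ ⊔ Ideal.span {u} ⊔ Ideal.span {u'} ⊔ Ideal.span {τ}).restrictScalars ℂ) ⊓ VV k
    ≤ VV k := inf_le_right
  have heq := Submodule.eq_of_le_of_finrank_eq hle (by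
    change hf _ _ = _
    zify
    push_cast at c3
    linarith)
  have hs' : s ∈ VV k := mem_VV_nat.2 hs
  rw [← heq] at hs'
  have hs2 : s ∈ ⊥ ⊔ Ideal.span {u} ⊔ Ideal.span {u'} ⊔ Ideal.span {τ} := hs'.1
  rw [eI] at hs2
  obtain ⟨i, hi, j, hj, rfl⟩ := Submodule.mem_sup.1 hs2
  obtain ⟨x, y, rfl⟩ := Ideal.mem_span_pair.1 hi
  obtain ⟨z, rfl⟩ := Ideal.mem_span_singleton.1 hj
  exact ⟨x, y, z, by ring⟩


def gr (f : S) : Fin 3 → S := fun i => pderiv i f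

lemma mem_Jf {f q : S} : q ∈ Jf f ↔ ∃ η : Fin 3 → S, dt η (gr f) = q := by
  unfold Jf
  rw [show ({pderiv 0 f, pderiv 1 f, pderiv 2 f} : Set S) = insert (pderiv 0 f) {pderiv 1 f, pderiv 2 f} from rfl,
    Ideal.mem_span_insert]
  constructor
  · rintro ⟨a, z, hz, rfl⟩
    obtain ⟨b, c, rfl⟩ := Ideal.mem_span_pair.1 hz
    exact ⟨![a, b, c], by simp [dt, gr]; ring⟩
  · rintro ⟨η, rfl⟩
    exact ⟨η 0, η 1 * pderiv 1 f + η 2 * pderiv 2 f, Ideal.mem_span_pair.2 ⟨_, _, rfl⟩,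
      by simp [dt, gr]; ring⟩

lemma mem_AR {f : S} {r : Fin 3 → S} : r ∈ ARmod f ↔ dt r (gr f) = 0 := by
  unfold ARmod
  rw [LinearMap.mem_ker]
  change ∑ i, r i * pderiv i f = 0 ↔ _
  rw [Fin.sum_univ_three]; rfl

lemma gr_hom {f : S} {d : ℕ} (h : f.IsHomogeneous d) (i : Fin 3) : (gr f i).IsHomogeneous (d - 1) :=
  h.pderiv

lemma Nmod_ne {f : S} (h : Nmod f ≠ ⊥) : ¬ ∀ q, (∀ i, X i * q ∈ Jf f) → q ∈ Jf f := by
  intro hs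
  apply h
  have : Isat f ≤ Jf f := Isat_le le_rfl hs
  unfold Nmod
  rw [eq_bot_iff]
  rintro _ ⟨q, hq, rfl⟩
  rw [Submodule.mem_bot]
  exact (Submodule.Quotient.mk_eq_zero _).2 (this hq)

lemma deg_pos {f : S} {d : ℕ} (h : f.IsHomogeneous d) (hN : Nmod f ≠ ⊥) : 1 ≤ d := by
  by_contra hd
  obtain rfl : d = 0 := by omega
  apply Nmod_ne hN
  have hf : f = C (coeff 0 f) := by
    rw [← totalDegree_eq_zero_iff_eq_C]
    exact Nat.le_zero.1 h.totalDegree_le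
  have hg : ∀ i, gr f i = 0 := by
    intro i; unfold gr; rw [hf]; simp
  intro q hq
  obtain ⟨η, hη⟩ := mem_Jf.1 (hq 0)
  simp only [dt, hg] at hη
  have : q = 0 := by
    have h2 : (X 0 : S) * q = 0 := by rw [← hη]; ring
    exact (mul_eq_zero.1 h2).resolve_left (X_ne_zero 0)
  rw [this]; exact zero_mem _

lemma not_dvd_pderiv {p : S} (hp : Irreducible p) : ¬ ∀ i, p ∣ pderiv i p := by
  intro h
  have hz : ∀ i, pderiv i p = 0 := by
    intro i
    by_contra hne
    have h1 := totalDegree_le_of_dvd_of_isDomain (h i) hne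
    by_cases hpt : p.totalDegree = 0
    · rw [totalDegree_eq_zero_iff_eq_C] at hpt
      apply hne; rw [hpt]; simp
    · have h2 : (pderiv i p).totalDegree < p.totalDegree := by
        unfold totalDegree
        rw [Finset.sup_lt_iff (by change 0 < p.totalDegree; omega)]
        intro m hm
        rw [mem_support_iff, coeff_pderiv] at hm
        have h3 := le_totalDegree (mem_support_iff.2 (left_ne_zero_of_mul hm))
        have h4 : (m + Finsupp.single i 1).degree = m.degree + 1 := by simp
        change (m + Finsupp.single i 1).degree ≤ p.totalDegree at h3
        change m.degree < p.totalDegree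
        omega
      omega
  have hC : p = C (coeff 0 p) := by
    ext m
    rw [coeff_C]
    split_ifs with hm
    · rw [← hm]
    · obtain ⟨i, hi⟩ : ∃ i, m i ≠ 0 := by
        by_contra hh; push Not at hh
        exact hm (Finsupp.ext fun i => (hh i).symm)
      have h3 := congrArg (coeff (m - Finsupp.single i 1)) (hz i)
      rw [coeff_pderiv, coeff_zero, tsub_add_cancel_of_le (by
        simpa [Finsupp.single_le_iff] using Nat.one_le_iff_ne_zero.2 hi)] at h3
      refine (mul_eq_zero.1 h3).resolve_right ?_
      norm_cast
  apply hp.not_isUnit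
  rw [hC]
  refine IsUnit.map C (isUnit_iff_ne_zero.2 fun h0 => hp.ne_zero ?_)
  rw [hC, h0, map_zero]

lemma CT_gr {f : S} {d : ℕ} (h : f.IsHomogeneous d) (hd : 1 ≤ d) (hs : Squarefree f) : CT (gr f) := by
  apply CT_of
  intro p hp hdv
  have hf : p ∣ f := by
    have h1 := h.sum_X_mul_pderiv
    have h2 : p ∣ (d • f : S) := by
      rw [← h1]
      exact Finset.dvd_sum fun i _ => Dvd.dvd.mul_left (hdv i) _
    have h3 : f = C ((d : ℂ)⁻¹) * (d • f) := by
      rw [nsmul_eq_mul, ← mul_assoc, show ((d : ℕ) : S) = C (d : ℂ) by simp, ← C_mul,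
        inv_mul_cancel₀ (by exact_mod_cast (by omega : d ≠ 0)), C_1, one_mul]
    rw [h3]; exact Dvd.dvd.mul_left h2 _
  obtain ⟨q, rfl⟩ := hf
  apply not_dvd_pderiv hp
  intro i
  have h1 := hdv i
  simp only [gr] at h1
  rw [Derivation.leibniz, smul_eq_mul, smul_eq_mul] at h1
  have h2 : p ∣ q * pderiv i p := (dvd_add_right (Dvd.intro _ rfl)).1 h1
  refine (hp.prime.dvd_or_dvd h2).resolve_left ?_
  rintro ⟨q', rfl⟩
  exact hp.not_isUnit (hs p ⟨q', by ring⟩)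

lemma hc_dt {r g : Fin 3 → S} {D : ℕ} (hg : ∀ i, (g i).IsHomogeneous D) (k : ℕ) :
    hc (k + D) (dt r g) = dt (fun i => hc k (r i)) g := by
  simp only [dt, map_add, hc_mul_hom (hg _)]

lemma CT_r {f : S} {d d1 : ℕ} (h : f.IsHomogeneous d) (hl : IsLeast (mdrSet f) d1)
    {r : Fin 3 → S} (hr : dt r (gr f) = 0) (hr0 : r ≠ 0) (hrh : ∀ i, (r i).IsHomogeneous d1) :
    CT r := by
  apply CT_of
  intro p hp hdv
  choose s hs using hdv
  have hs0 : dt s (gr f) = 0 := by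
    have : p * dt s (gr f) = 0 := by
      rw [← hr]; simp only [dt, hs]; ring
    exact (mul_eq_zero.1 this).resolve_left hp.ne_zero
  obtain ⟨i, hi⟩ : ∃ i, s i ≠ 0 := by
    by_contra hh; push Not at hh
    apply hr0; funext i; rw [hs i, hh i, mul_zero]; rfl
  have hdeg : (s i).totalDegree < d1 := by
    have h1 := (hrh i).totalDegree (by rw [hs i]; exact mul_ne_zero hp.ne_zero hi)
    rw [hs i, totalDegree_mul_of_isDomain hp.ne_zero hi] at h1
    have : p.totalDegree ≠ 0 := by
      intro h0
      rw [totalDegree_eq_zero_iff_eq_C] at h0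
      apply hp.not_isUnit
      rw [h0]
      refine IsUnit.map C (isUnit_iff_ne_zero.2 fun h0' => hp.ne_zero ?_)
      rw [h0, h0', map_zero]
    omega
  obtain ⟨k, hk, hk0⟩ : ∃ k < d1, hc k (s i) ≠ 0 := by
    by_contra hh; push Not at hh
    apply hi
    rw [← sum_homogeneousComponent (s i)]
    refine Finset.sum_eq_zero fun k hk => hh k ?_
    have := Finset.mem_range.1 hk
    omega
  have := hl.2 (show k ∈ mdrSet f from ⟨fun j => hc k (s j), mem_AR.2 (by
    rw [← hc_dt (gr_hom h), hs0, map_zero]), fun h0 => hk0 (congrFun h0 i), fun j => hc_hom _ _⟩)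
  omega

def inB (g r : Fin 3 → S) (β : S) : Prop := ∃ s, dt s g = 0 ∧ ∀ i, cr r s i = β * g i

lemma cr_lin (r a b : Fin 3 → S) (x y : S) (i : Fin 3) :
    cr r (fun j => x * a j + y * b j) i = x * cr r a i + y * cr r b i := by
  fin_cases i <;> simp [cr] <;> ring

lemma dt_lin (g a b : Fin 3 → S) (x y : S) :
    dt (fun j => x * a j + y * b j) g = x * dt a g + y * dt b g := by
  simp only [dt]; ring

lemma cr_self (r : Fin 3 → S) (i : Fin 3) : cr r r i = 0 := by
  fin_cases i <;> simp [cr] <;> ring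

lemma inB_lin {g r : Fin 3 → S} {β γ : S} (x y : S) (h1 : inB g r β) (h2 : inB g r γ) :
    inB g r (x * β + y * γ) := by
  obtain ⟨s, hs, hs'⟩ := h1
  obtain ⟨t, ht, ht'⟩ := h2
  refine ⟨fun j => x * s j + y * t j, by rw [dt_lin, hs, ht]; ring, fun i => ?_⟩
  rw [cr_lin, hs', ht']; ring

def BI (g r : Fin 3 → S) : Ideal S where
  carrier := {β | inB g r β}
  zero_mem' := ⟨0, by simp [dt], fun i => by fin_cases i <;> simp [cr]⟩
  add_mem' := by
    intro a b ha hb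
    have := inB_lin 1 1 ha hb
    simpa using this
  smul_mem' := by
    intro c a ha
    have := inB_lin c 0 ha ha
    simpa using this

lemma mem_BI {g r : Fin 3 → S} {β : S} : β ∈ BI g r ↔ inB g r β := Iff.rfl

lemma BI_hom {g r : Fin 3 → S} {D d1 : ℕ} (hg : ∀ i, (g i).IsHomogeneous D)
    (hr : ∀ i, (r i).IsHomogeneous d1) {β : S} (h : inB g r β) (k e : ℕ) (hk : e + d1 = k + D) :
    ∃ s, (∀ i, (s i).IsHomogeneous e) ∧ dt s g = 0 ∧ ∀ i, cr r s i = hc k β * g i := by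
  obtain ⟨s, hs, hs'⟩ := h
  refine ⟨fun i => hc e (s i), fun i => hc_hom _ _, ?_, fun i => ?_⟩
  · rw [← hc_dt hg, hs, map_zero]
  · rw [← hc_mul_hom (hg i), ← hs' i]
    fin_cases i <;> simp only [cr, Fin.zero_eta, Fin.isValue, Fin.mk_one, Fin.reduceFinMk,
      Matrix.cons_val, map_sub] <;>
      rw [hc_mul_hom' (hr _) _ e _ (by omega), hc_mul_hom' (hr _) _ e _ (by omega)]

/-- `r i` lies in `BI`. -/
lemma r_mem_BI {g r : Fin 3 → S} (hr : dt r g = 0) (i : Fin 3) : r i ∈ BI g r := by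
  simp only [dt] at hr
  fin_cases i
  · refine ⟨![0, g 2, - g 1], by simp [dt]; ring, fun j => ?_⟩
    fin_cases j <;> simp [cr] <;> linear_combination -hr
  · refine ⟨![-g 2, 0, g 0], by simp [dt]; ring, fun j => ?_⟩
    fin_cases j <;> simp [cr] <;> linear_combination -hr
  · refine ⟨![g 1, -g 0, 0], by simp [dt]; ring, fun j => ?_⟩
    fin_cases j <;> simp [cr] <;> linear_combination -hr

/-- if `δ(r,s)=0` then `s` is a multiple of `r` -/
lemma mult_r {r s : Fin 3 → S} (hr : CT r) (h : ∀ i, cr r s i = 0) : ∃ k, ∀ i, s i = k * r i :=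
  parallel_cr hr (funext h)

lemma one_notMem {g r : Fin 3 → S} (hg : CT g) (hr : CT r) (hrg : dt r g = 0)
    (hns : ¬ ∀ q, (∀ i, ∃ η, dt η g = X i * q) → ∃ η, dt η g = q) : ¬ inB g r 1 := by
  rintro ⟨s, hs, hs'⟩
  apply hns
  intro q hq
  let φ : (Fin 3 → S) →ₗ[S] S :=
    { toFun := fun a => dt a g
      map_add' := fun a b => by simp [dt]; ring
      map_smul' := fun a b => by simp [dt]; ring }
  let ψ : (Fin 2 → S) →ₗ[S] (Fin 3 → S) :=
    { toFun := fun a j => a 0 * r j + a 1 * s j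
      map_add' := fun a b => by funext j; simp; ring
      map_smul' := fun a b => by funext j; simp; ring }
  have hφ : ∀ a, φ a = dt a g := fun a => rfl
  have hψ : ∀ a, ψ a = fun j => a 0 * r j + a 1 * s j := fun a => rfl
  refine sat D2_pi φ ψ ?_ ?_ ?_ q hq
  · intro a ha
    have h1 : a 1 = 0 := by
      apply CT_cancel hg
      intro i
      have h2 := cr_lin r r s (a 0) (a 1) i
      rw [← hψ, ha, cr_self, hs'] at h2
      have h3 : cr r 0 i = 0 := by fin_cases i <;> simp [cr]
      rw [h3] at h2
      linear_combination -h2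
    have h0 : a 0 = 0 := by
      apply CT_cancel hr
      intro i
      have := congrFun ha i
      rw [hψ] at this
      simpa [h1] using this
    funext i; fin_cases i
    · exact h0
    · exact h1
  · intro a
    rw [hφ, hψ, dt_lin, hrg, hs]; ring
  · intro A hA
    obtain ⟨k, hk⟩ := delta hg hrg (s := A) hA
    obtain ⟨m, hm⟩ := mult_r hr (s := fun j => 1 * A j + (-k) * s j) (fun i => by
      rw [cr_lin, hk, hs']; ring)
    refine ⟨![m, k], ?_⟩
    rw [hψ]; funext j
    have := hm j
    simp
    linear_combination -this

lemma BI_sat {g r : Fin 3 → S} (hg : CT g) (hr : CT r) (hrg : dt r g = 0) (q : S)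
    (h : ∀ i, X i * q ∈ BI g r) : q ∈ BI g r := by
  let F : Submodule S ((Fin 3 → S) × S) :=
    { carrier := {A | dt A.1 g = 0 ∧ ∀ i, cr r A.1 i = A.2 * g i}
      zero_mem' := ⟨by simp [dt], fun i => by fin_cases i <;> simp [cr]⟩
      add_mem' := by
        rintro a b ⟨ha, ha'⟩ ⟨hb, hb'⟩
        have e : (a + b).1 = fun j => 1 * a.1 j + 1 * b.1 j := by funext j; simp
        refine ⟨by rw [e, dt_lin, ha, hb]; ring, fun i => ?_⟩
        rw [e, cr_lin, ha', hb']; simp; ring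
      smul_mem' := by
        rintro c a ⟨ha, ha'⟩
        have e : (c • a).1 = fun j => c * a.1 j + 0 * a.1 j := by funext j; simp
        refine ⟨by rw [e, dt_lin, ha]; ring, fun i => ?_⟩
        rw [e, cr_lin, ha']; simp; ring }
  have hF : D2 F := by
    intro a b hab
    obtain ⟨c, hc⟩ := D2_prod D2_pi D2_self a.1 b.1 (congrArg Subtype.val hab)
    have hx : (X 0 : S) ≠ 0 := X_ne_zero 0
    have ha := a.2.1
    have ha' := a.2.2
    rw [hc] at ha ha'
    refine ⟨⟨c, ?_, fun i => ?_⟩, Subtype.ext hc⟩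
    · apply mul_left_cancel₀ hx
      simp only [dt, Prod.smul_fst, Pi.smul_apply, smul_eq_mul] at ha ⊢
      linear_combination ha
    · apply mul_left_cancel₀ hx
      have := ha' i
      have e : ((X 0 : S) • c).1 = fun j => X 0 * c.1 j + 0 * c.1 j := by funext j; simp
      rw [e, cr_lin] at this
      simp only [Prod.smul_snd, smul_eq_mul] at this ⊢
      linear_combination this
  let φ : F →ₗ[S] S := (LinearMap.snd S _ S).comp F.subtype
  let ψ : (Fin 1 → S) →ₗ[S] F :=
    { toFun := fun a => ⟨(fun j => a 0 * r j + 0 * r j, 0), by rw [dt_lin, hrg]; ring,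
          fun i => by rw [cr_lin, cr_self]; ring⟩
      map_add' := fun a b => by
        apply Subtype.ext; ext1
        · funext j; simp; ring
        · simp
      map_smul' := fun a b => by
        apply Subtype.ext; ext1
        · funext j; simp; ring
        · simp }
  suffices key : ∃ A, φ A = q by
    obtain ⟨A, rfl⟩ := key
    exact ⟨A.1.1, A.2.1, A.2.2⟩
  refine sat hF φ ψ ?_ ?_ ?_ q ?_
  · intro a ha
    have h0 : a 0 = 0 := by
      apply CT_cancel hr
      intro i
      have := congrFun (congrArg (fun z : F => z.1.1) ha) i
      simpa [ψ] using this
    funext i; fin_cases i; exact h0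
  · intro a; rfl
  · rintro ⟨⟨A, β⟩, hA, hA'⟩ h0
    have hβ : β = 0 := h0
    subst hβ
    obtain ⟨k, hk⟩ := mult_r hr (s := A) (fun i => by rw [hA' i]; simp)
    refine ⟨fun _ => k, ?_⟩
    apply Subtype.ext; ext1
    · funext j; simp [ψ]; exact (hk j).symm
    · rfl
  · intro i
    obtain ⟨s, hs, hs'⟩ := h i
    exact ⟨⟨(s, _), hs, hs'⟩, rfl⟩


lemma not_one {u u' : S} {e : ℕ} (he : 1 ≤ e) (hu : u.IsHomogeneous e) (hu' : u'.IsHomogeneous e)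
    (x y : S) (h : x * u + y * u' = 1) : False := by
  have h1 : ∀ {v : S}, v.IsHomogeneous e → constantCoeff v = 0 := by
    intro v hv
    rw [constantCoeff_eq]
    exact hv.coeff_eq_zero (by simp; omega)
  have := congrArg constantCoeff h
  simp [h1 hu, h1 hu'] at this

lemma dt_hom {c r : Fin 3 → S} {e : ℕ} (hc : ∀ i, (c i).IsHomogeneous 0)
    (hr : ∀ i, (r i).IsHomogeneous e) : (dt c r).IsHomogeneous e := by
  have h : ∀ i, (c i * r i).IsHomogeneous e := fun i => by
    have := (hc i).mul (hr i); rwa [zero_add] at this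
  exact ((h 0).add (h 1)).add (h 2)

lemma sum_dt (c : Fin 3 → ℂ) (r : Fin 3 → S) :
    ∑ i, C (c i) * r i = dt (fun i => C (c i)) r := by
  rw [Fin.sum_univ_three]; rfl

lemma exists_reg {r : Fin 3 → S} {e : ℕ} (he : 1 ≤ e) (hr : ∀ i, (r i).IsHomogeneous e)
    (hct : CT r) : ∃ c c' : Fin 3 → S, ∃ t : S, (∀ i, (c i).IsHomogeneous 0) ∧
      (∀ i, (c' i).IsHomogeneous 0) ∧ t.IsHomogeneous 1 ∧ dt c r ≠ 0 ∧ dt c' r ≠ 0 ∧ t ≠ 0 ∧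
      (∀ a, dt c r ∣ dt c' r * a → dt c r ∣ a) ∧
      (∀ a, t * a ∈ Ideal.span {dt c r, dt c' r} → a ∈ Ideal.span {dt c r, dt c' r}) := by
  obtain ⟨c, hc0, hc⟩ : ∃ c : Fin 3 → S, (∀ i, (c i).IsHomogeneous 0) ∧ dt c r ≠ 0 := by
    obtain ⟨i, hi⟩ := CT_ne hct
    fin_cases i
    · exact ⟨![1, 0, 0], fun i => by fin_cases i <;> simp [isHomogeneous_one, isHomogeneous_zero],
        by simpa [dt] using hi⟩
    · exact ⟨![0, 1, 0], fun i => by fin_cases i <;> simp [isHomogeneous_one, isHomogeneous_zero],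
        by simpa [dt] using hi⟩
    · exact ⟨![0, 0, 1], fun i => by fin_cases i <;> simp [isHomogeneous_one, isHomogeneous_zero],
        by simpa [dt] using hi⟩
  obtain ⟨c', hc'⟩ := exists_nzd (Ideal.span {dt c r}) r (fun w hw => by
    simp only [Ideal.mem_span_singleton] at hw ⊢
    exact hct _ _ hw)
  rw [sum_dt] at hc'
  simp only [Ideal.mem_span_singleton] at hc'
  have hC : ∀ i, ((fun i => C (c' i) : Fin 3 → S) i).IsHomogeneous 0 := fun i => isHomogeneous_C _ _
  set c2 : Fin 3 → S := fun i => C (c' i) with hc2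
  have hu := dt_hom hc0 hr
  have hu' := dt_hom hC hr
  obtain ⟨a, ha⟩ := exists_nzd (Ideal.span {dt c r, dt c2 r}) X (fun w hw => sat_pair hc hc' w hw)
  refine ⟨c, c2, lin a, hc0, hC, lin_hom a, hc, ?_, ?_, hc', ha⟩
  · intro h0
    obtain ⟨y, hy⟩ := hc' 1 (by rw [h0, zero_mul]; exact dvd_zero _)
    exact not_one he hu hu' y 0 (by rw [hy]; ring)
  · intro h0
    have h0' : ∑ i, C (a i) * X i = (0 : S) := h0
    have := ha 1 (by rw [h0', zero_mul]; exact zero_mem _)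
    obtain ⟨x, y, hxy⟩ := Ideal.mem_span_pair.1 this
    exact not_one he hu hu' x y hxy

def RelH (g r c c' : Fin 3 → S) (τ b H : S) : Prop :=
  ∃ α β γ : Fin 3 → S, ∃ A A' : S,
    (∀ i, b * cr c g i + A' * r i = dt c r * α i + τ * β i) ∧
    (∀ i, b * cr c' g i - A * r i = dt c' r * α i + τ * γ i) ∧ τ * H = dt α g

lemma id_w (g r c c' : Fin 3 → S) (hrg : dt r g = 0) (i : Fin 3) :
    dt c' r * cr c g i - dt c r * cr c' g i + dt g (cr c c') * r i = 0 := by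
  simp only [dt] at hrg
  fin_cases i <;> simp [dt, cr]
  · linear_combination (c 1 * c' 2 - c 2 * c' 1) * hrg
  · linear_combination (c 2 * c' 0 - c 0 * c' 2) * hrg
  · linear_combination (c 0 * c' 1 - c 1 * c' 0) * hrg

lemma id_cg (g c : Fin 3 → S) : dt (cr c g) g = 0 := by
  simp [dt, cr]; ring

lemma id_rc (g r c : Fin 3 → S) (hrg : dt r g = 0) (i : Fin 3) :
    cr r (cr c g) i = - dt c r * g i := by
  simp only [dt] at hrg
  fin_cases i <;> simp [dt, cr]
  · linear_combination c 0 * hrg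
  · linear_combination c 1 * hrg
  · linear_combination c 2 * hrg

/-- consequences of two equations -/
lemma two_eq {u u' τ a p q : S} (hu : u ≠ 0) (hτ : τ ≠ 0) (h12 : ∀ a, u ∣ u' * a → u ∣ a)
    (h1 : u * a + τ * p = 0) (h2 : u' * a + τ * q = 0) :
    ∃ k, a = τ * k ∧ p = - (u * k) ∧ q = - (u' * k) := by
  have h3 : u * q = u' * p := by
    apply mul_left_cancel₀ hτ
    linear_combination u * h2 - u' * h1
  obtain ⟨k, hk⟩ := h12 p ⟨q, h3.symm⟩
  refine ⟨-k, ?_, by rw [hk]; ring, ?_⟩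
  · apply mul_left_cancel₀ hu
    rw [hk] at h1
    linear_combination h1
  · apply mul_left_cancel₀ hu
    rw [hk] at h3
    linear_combination h3

section
variable {g r c c' : Fin 3 → S} {τ : S}

lemma dt_eqs {b A : S} {α β d : Fin 3 → S} {u : S} (hrg : dt r g = 0)
    (h : ∀ i, b * cr d g i + A * r i = u * α i + τ * β i) :
    u * dt α g + τ * dt β g = 0 := by
  have h0 := h 0
  have h1 := h 1
  have h2 := h 2
  have h3 := id_cg g d
  simp only [dt] at hrg h3 ⊢
  linear_combination A * hrg + b * h3 - g 0 * h0 - g 1 * h1 - g 2 * h2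

lemma Rel_J
    (hrg : dt r g = 0) (hu : dt c r ≠ 0) (hτ : τ ≠ 0)
    (h12 : ∀ a, dt c r ∣ dt c' r * a → dt c r ∣ a)
    {b H : S} (h : RelH g r c c' τ b H) :
    (∃ η, dt η g = dt c r * H) ∧ (∃ η, dt η g = dt c' r * H) ∧ (∃ η, dt η g = τ * H) := by
  obtain ⟨α, β, γ, A, A', h1, h2, h3⟩ := h
  have e1 := dt_eqs hrg h1
  have e2 := dt_eqs (A := -A) (b := b) (d := c') (α := α) (β := γ) (u := dt c' r) hrg (fun i => by rw [← h2 i]; ring)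
  have hn : ∀ a : Fin 3 → S, dt (fun i => - a i) g = - dt a g := by intro a; simp only [dt]; ring
  refine ⟨⟨fun i => - β i, ?_⟩, ⟨fun i => - γ i, ?_⟩, ⟨α, h3.symm⟩⟩
  · rw [hn]; apply mul_left_cancel₀ hτ; linear_combination -e1 - dt c r * h3
  · rw [hn]; apply mul_left_cancel₀ hτ; linear_combination -e2 - dt c' r * h3

lemma Rel_ex
    (hrg : dt r g = 0) (hu : dt c r ≠ 0) (hτ : τ ≠ 0)
    (h12 : ∀ a, dt c r ∣ dt c' r * a → dt c r ∣ a)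
    (h3 : ∀ a, (∃ x y, τ * a = x * dt c r + y * dt c' r) → ∃ x y, a = x * dt c r + y * dt c' r)
    {b : S} (hb : ∃ x y z, b * dt g (cr c c') = x * dt c r + y * dt c' r + z * τ) :
    ∃ H, RelH g r c c' τ b H := by
  obtain ⟨A, A', A'', hb⟩ := hb
  obtain ⟨x, y, z, h⟩ := K2v hu h12 h3 (fun i => - (b * cr c' g i - A * r i))
    (fun i => b * cr c g i + A' * r i) (fun i => A'' * r i) (fun i => by
      have := id_w g r c c' hrg i
      linear_combination b * this - r i * hb)
  have E1 : ∀ i, b * cr c g i + A' * r i = dt c r * z i + τ * (fun i => - y i) i := fun i => by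
    rw [(h i).2.1]; ring
  have E2 : ∀ i, b * cr c' g i - A * r i = dt c' r * z i + τ * x i := fun i => by
    linear_combination - (h i).1
  have e1 := dt_eqs hrg E1
  have e2 := dt_eqs (A := -A) (b := b) (d := c') (α := z) (β := x) (u := dt c' r) hrg (fun i => by rw [← E2 i]; ring)
  obtain ⟨H, hH, _, _⟩ := two_eq hu hτ h12 e1 e2
  exact ⟨H, z, _, x, A, A', E1, E2, hH.symm⟩

lemma Rel_lin {b b' H H' : S} (x y : S) (h : RelH g r c c' τ b H) (h' : RelH g r c c' τ b' H') :
    RelH g r c c' τ (x * b + y * b') (x * H + y * H') := by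
  obtain ⟨α, β, γ, A, A', h1, h2, h3⟩ := h
  obtain ⟨α', β', γ', B, B', h1', h2', h3'⟩ := h'
  refine ⟨fun i => x * α i + y * α' i, fun i => x * β i + y * β' i, fun i => x * γ i + y * γ' i,
    x * A + y * B, x * A' + y * B', fun i => ?_, fun i => ?_, ?_⟩
  · linear_combination x * h1 i + y * h1' i
  · linear_combination x * h2 i + y * h2' i
  · rw [dt_lin]; linear_combination x * h3 + y * h3'

lemma cr_hom0 {D : ℕ} (hc0 : ∀ i, (c i).IsHomogeneous 0) (hg : ∀ i, (g i).IsHomogeneous D)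
    (i : Fin 3) : (cr c g i).IsHomogeneous D := by
  have h : ∀ i j, (c i * g j).IsHomogeneous D := fun i j => by
    have := (hc0 i).mul (hg j); rwa [zero_add] at this
  fin_cases i
  · exact (h 1 2).sub (h 2 1)
  · exact (h 2 0).sub (h 0 2)
  · exact (h 0 1).sub (h 1 0)

lemma Rel_hom {D d1 m : ℕ} (hd1 : 1 ≤ d1) (hm : d1 + d1 + m = D + 3) (hm2 : 2 ≤ m)
    (hg : ∀ i, (g i).IsHomogeneous D) (hr : ∀ i, (r i).IsHomogeneous d1)
    (hc0 : ∀ i, (c i).IsHomogeneous 0) (hc0' : ∀ i, (c' i).IsHomogeneous 0)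
    (hτm : τ.IsHomogeneous m) {b H : S} (hb : b.IsHomogeneous 1) (h : RelH g r c c' τ b H) :
    RelH g r c c' τ b (hc (D + d1 - 2) H) := by
  obtain ⟨α, β, γ, A, A', h1, h2, h3⟩ := h
  refine ⟨fun i => hc (D + 1 - d1) (α i), fun i => hc (D + 1 - m) (β i),
    fun i => hc (D + 1 - m) (γ i), hc (D + 1 - d1) A, hc (D + 1 - d1) A', fun i => ?_,
    fun i => ?_, ?_⟩
  · have := congrArg (hc (D + 1)) (h1 i)
    rw [map_add, map_add, mul_comm A', hc_mul_hom' (hr i) _ (D + 1 - d1) _ (by omega),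
      hc_mul_hom' (dt_hom hc0 hr) _ (D + 1 - d1) _ (by omega),
      hc_mul_hom' hτm _ (D + 1 - m) _ (by omega),
      hc_self (by have := hb.mul (cr_hom0 hc0 hg i); rwa [add_comm] at this)] at this
    rw [mul_comm _ (r i)]; exact this
  · have := congrArg (hc (D + 1)) (h2 i)
    rw [map_sub, map_add, mul_comm A, hc_mul_hom' (hr i) _ (D + 1 - d1) _ (by omega),
      hc_mul_hom' (dt_hom hc0' hr) _ (D + 1 - d1) _ (by omega),
      hc_mul_hom' hτm _ (D + 1 - m) _ (by omega),
      hc_self (by have := hb.mul (cr_hom0 hc0' hg i); rwa [add_comm] at this)] at this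
    rw [mul_comm _ (r i)]; exact this
  · rw [← hc_dt hg, ← h3, hc_mul_hom' hτm _ (D + d1 - 2) _ (by omega)]

lemma Rel_inj
    (hrg : dt r g = 0) (hu : dt c r ≠ 0) (hτ : τ ≠ 0)
    (h12 : ∀ a, dt c r ∣ dt c' r * a → dt c r ∣ a)
    {D d1 m : ℕ} (hgc : CT g) (hm : d1 + d1 + m = D + 3) (hm2 : 2 ≤ m)
    (hg : ∀ i, (g i).IsHomogeneous D) (hr : ∀ i, (r i).IsHomogeneous d1)
    (hτm : τ.IsHomogeneous m) {b : S} {η : Fin 3 → S} (hb : b.IsHomogeneous 1)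
    (h : RelH g r c c' τ b (dt η g)) : inB g r b := by
  obtain ⟨α, β, γ, A, A', h1, h2, h3⟩ := h
  have e1 := dt_eqs hrg h1
  have e2 := dt_eqs (A := -A) (b := b) (d := c') (α := α) (β := γ) (u := dt c' r) hrg (fun i => by rw [← h2 i]; ring)
  have k1 : dt (fun j => 1 * α j + (-τ) * η j) g = 0 := by rw [dt_lin]; linear_combination -h3
  have k2 : dt (fun j => 1 * β j + (dt c r) * η j) g = 0 := by
    rw [dt_lin]; apply mul_left_cancel₀ hτ; linear_combination e1 + dt c r * h3
  have k3 : dt (fun j => 1 * γ j + (dt c' r) * η j) g = 0 := by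
    rw [dt_lin]; apply mul_left_cancel₀ hτ; linear_combination e2 + dt c' r * h3
  obtain ⟨x0, hx0⟩ := delta hgc hrg k1
  obtain ⟨y, hy⟩ := delta hgc hrg k2
  obtain ⟨y', hy'⟩ := delta hgc hrg k3
  have q1 : ∀ i, dt c r * (cr r (fun j => 1 * α j + (-τ) * η j) i) +
      τ * (cr r (fun j => 1 * β j + (dt c r) * η j) i) = - (b * dt c r * g i) := by
    intro i
    rw [← cr_lin]
    have : (fun j => dt c r * (1 * α j + -τ * η j) + τ * (1 * β j + dt c r * η j)) =
      fun j => b * cr c g j + A' * r j := by funext j; rw [h1 j]; ring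
    rw [this, cr_lin, id_rc _ _ _ hrg, cr_self]; ring
  have q2 : ∀ i, dt c' r * (cr r (fun j => 1 * α j + (-τ) * η j) i) +
      τ * (cr r (fun j => 1 * γ j + (dt c' r) * η j) i) = - (b * dt c' r * g i) := by
    intro i
    rw [← cr_lin]
    have : (fun j => dt c' r * (1 * α j + -τ * η j) + τ * (1 * γ j + dt c' r * η j)) =
      fun j => b * cr c' g j + (-A) * r j := by funext j; linear_combination - h2 j
    rw [this, cr_lin, id_rc _ _ _ hrg, cr_self]; ring
  have p1 : dt c r * (b + x0) + τ * y = 0 := by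
    apply CT_cancel hgc; intro i
    have := q1 i
    rw [hx0, hy] at this
    linear_combination this
  have p2 : dt c' r * (b + x0) + τ * y' = 0 := by
    apply CT_cancel hgc; intro i
    have := q2 i
    rw [hx0, hy'] at this
    linear_combination this
  obtain ⟨k, hk, _, _⟩ := two_eq hu hτ h12 p1 p2
  have hz := congrArg (hc 1) hk
  rw [map_add, hc_self hb, hc_mul_hom_lt hτm _ _ (by omega)] at hz
  obtain ⟨s, _, hs, hs'⟩ := BI_hom hg hr (β := x0) ⟨_, k1, hx0⟩ 1 (D + 1 - d1) (by omega)
  have : inB g r (hc 1 x0) := ⟨s, hs, hs'⟩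
  have hbb : b = (-1) * hc 1 x0 + 0 * hc 1 x0 := by linear_combination hz
  rw [hbb]
  exact inB_lin _ _ this this
end


lemma dt_comm (a b : Fin 3 → S) : dt a b = dt b a := by simp only [dt]; ring

lemma pow_nzd {I : Ideal S} {t : S} (h : ∀ a, t * a ∈ I → a ∈ I) (m : ℕ) (a : S)
    (ha : t ^ m * a ∈ I) : a ∈ I := by
  induction m with
  | zero => simpa using ha
  | succ m ih =>
    apply ih
    apply h
    rw [← mul_assoc, ← pow_succ']; exact ha

instance (f : S) (k : ℕ) : FiniteDimensional ℂ (Nsub f k) := by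
  unfold Nsub; infer_instance

lemma two_lin {f : S} {d d1 : ℕ} (hh : f.IsHomogeneous d) (hd : 1 ≤ d) (hgc : CT (gr f))
    {r : Fin 3 → S} (hrg : dt r (gr f) = 0) (hr : ∀ i, (r i).IsHomogeneous d1) (hct : CT r)
    (h2 : 2 * d1 ≤ d) (hd1 : 1 ≤ d1) (hnd : ∀ k, ndim f k ≤ 1) :
    ∃ a b : Fin 3 → ℂ,
      ![a 1 * b 2 - a 2 * b 1, a 2 * b 0 - a 0 * b 2, a 0 * b 1 - a 1 * b 0] ≠ 0 ∧
      inB (gr f) r (lin a) ∧ inB (gr f) r (lin b) := by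
  obtain ⟨c, c', t, hc0, hc0', ht, hu, hu', ht0, h12, h3⟩ := exists_reg hd1 hr hct
  obtain ⟨m, hm⟩ : ∃ m, d1 + d1 + m = (d - 1) + 3 := ⟨d + 2 - 2 * d1, by omega⟩
  have hm2 : 2 ≤ m := by omega
  have hg := gr_hom hh
  have hτ0 : t ^ m ≠ 0 := pow_ne_zero _ ht0
  have hτ : (t ^ m).IsHomogeneous m := by simpa using ht.pow m
  have h3' := pow_nzd h3 m
  set τ := t ^ m
  have hU := dt_hom hc0 hr
  have hU' := dt_hom hc0' hr
  have h3'' : ∀ a, (∃ x y, τ * a = x * dt c r + y * dt c' r) →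
      ∃ x y, a = x * dt c r + y * dt c' r := by
    rintro a ⟨x, y, h⟩
    obtain ⟨x', y', h'⟩ := Ideal.mem_span_pair.1 (h3' a (Ideal.mem_span_pair.2 ⟨x, y, h.symm⟩))
    exact ⟨x', y', h'.symm⟩
  have hw : (dt (gr f) (cr c c')).IsHomogeneous (d - 1) := by
    rw [dt_comm]; exact dt_hom (cr_hom0 hc0 hc0') hg
  have hex : ∀ i : Fin 3, ∃ H, RelH (gr f) r c c' τ (X i) H := fun i =>
    Rel_ex hrg hu hτ0 h12 h3'' (TT hU hU' hτ hu hu' hτ0 h12 h3' (1 + (d - 1)) (by omega) _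
      ((isHomogeneous_X _ _).mul hw))
  choose H0 hH0 using hex
  let H : Fin 3 → S := fun i => hc (d - 1 + d1 - 2) (H0 i)
  have hH : ∀ i, RelH (gr f) r c c' τ (X i) (H i) := fun i =>
    Rel_hom hd1 hm hm2 hg hr hc0 hc0' hτ (isHomogeneous_X _ _) (hH0 i)
  have hHI : ∀ i, H i ∈ Isat f := by
    intro i
    refine desc (Isat f) (fun q => Isat_step) (H i) (d1 + d1 + m) ?_
    intro s hs
    obtain ⟨x, y, z, rfl⟩ := TT hU hU' hτ hu hu' hτ0 h12 h3' (d1 + d1 + m) (by omega) s hs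
    obtain ⟨j1, j2, j3⟩ := Rel_J hrg hu hτ0 h12 (hH i)
    apply Jf_le_Isat
    have : (x * dt c r + y * dt c' r + z * τ) * H i =
      x * (dt c r * H i) + y * (dt c' r * H i) + z * (τ * H i) := by ring
    rw [this]
    exact add_mem (add_mem (Ideal.mul_mem_left _ _ (mem_Jf.2 j1))
      (Ideal.mul_mem_left _ _ (mem_Jf.2 j2))) (Ideal.mul_mem_left _ _ (mem_Jf.2 j3))
  let L0 : (Fin 3 → ℂ) →ₗ[ℂ] S := ∑ i, (LinearMap.proj i).smulRight (H i)
  have hL0 : ∀ a, L0 a = C (a 0) * H 0 + C (a 1) * H 1 + C (a 2) * H 2 := by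
    intro a; simp [L0, Fin.sum_univ_three, smul_eq_C_mul]
  let L := (quotC f).comp L0
  have hrange : LinearMap.range L ≤ Nsub f (d - 1 + d1 - 2) := by
    rintro _ ⟨a, rfl⟩
    refine ⟨L0 a, ⟨?_, ?_⟩, rfl⟩
    · rw [hL0]
      change _ ∈ Isat f
      exact add_mem (add_mem (Ideal.mul_mem_left _ _ (hHI 0)) (Ideal.mul_mem_left _ _ (hHI 1)))
        (Ideal.mul_mem_left _ _ (hHI 2))
    · simp only [L0, LinearMap.sum_apply]
      refine Submodule.sum_mem _ fun i _ => ?_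
      exact Submodule.smul_mem _ _ (hc_hom _ _)
  have h1 : Module.finrank ℂ (LinearMap.range L) ≤ 1 :=
    (Submodule.finrank_mono hrange).trans (hnd _)
  have hrk := LinearMap.finrank_range_add_finrank_ker L
  rw [Module.finrank_fin_fun] at hrk
  have hk2 : 1 < Module.finrank ℂ (LinearMap.ker L) := by omega
  have : Nontrivial (LinearMap.ker L) := Module.nontrivial_of_finrank_pos (R := ℂ) (by omega)
  obtain ⟨x, hx⟩ := exists_ne (0 : LinearMap.ker L)
  obtain ⟨y, hxy⟩ := exists_linearIndependent_pair_of_one_lt_finrank hk2 hx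
  have hin : ∀ a ∈ LinearMap.ker L, inB (gr f) r (lin a) := by
    intro a ha
    have e1 : RelH (gr f) r c c' τ (lin a) (L0 a) := by
      have := Rel_lin (C (a 0)) (C (a 1)) (hH 0) (hH 1)
      have := Rel_lin 1 (C (a 2)) this (hH 2)
      rw [hL0, lin, Fin.sum_univ_three]
      simpa using this
    have e2 : L0 a ∈ Jf f := (Submodule.Quotient.mk_eq_zero _).1 ha
    obtain ⟨η, hη⟩ := mem_Jf.1 e2
    rw [← hη] at e1
    exact Rel_inj hrg hu hτ0 h12 hgc hm hm2 hg hr hτ (lin_hom a) e1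
  refine ⟨x, y, ?_, hin _ x.2, hin _ y.2⟩
  have hli : LinearIndependent ℂ ![(x : Fin 3 → ℂ), (y : Fin 3 → ℂ)] := by
    have := hxy.map' (LinearMap.ker L).subtype (Submodule.ker_subtype _)
    have e : ![(x : Fin 3 → ℂ), (y : Fin 3 → ℂ)] = (LinearMap.ker L).subtype ∘ ![x, y] := by
      funext i; fin_cases i <;> rfl
    rw [e]; exact this
  rw [← crossProduct_ne_zero_iff_linearIndependent, cross_apply] at hli
  exact hli

lemma B_le {g r : Fin 3 → S} {D d1 : ℕ} (hgc : CT g) (hct : CT r) (hrg : dt r g = 0)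
    (hg : ∀ i, (g i).IsHomogeneous D) (hr : ∀ i, (r i).IsHomogeneous d1) (hD : d1 ≤ D)
    (h1 : ¬ inB g r 1) {a b p : Fin 3 → ℂ}
    (hp : p = ![a 1 * b 2 - a 2 * b 1, a 2 * b 0 - a 0 * b 2, a 0 * b 1 - a 1 * b 0])
    (hp0 : p ≠ 0) (ha : inB g r (lin a)) (hb : inB g r (lin b)) {β : S} (hβ : inB g r β) :
    phi p β = 0 := by
  rw [← sum_homogeneousComponent β, map_sum]
  refine Finset.sum_eq_zero fun k _ => ?_
  change phi p (hc k β) = 0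
  rw [phi_hom p (hc_hom k β)]
  by_contra hne
  have he : eval p (hc k β) ≠ 0 := by
    intro h0; apply hne; rw [h0]; simp
  apply h1
  refine desc (BI g r) (BI_sat hgc hct hrg) 1 k ?_
  intro s hs
  rw [mul_one]
  obtain ⟨s', _, hs', hs''⟩ := BI_hom hg hr hβ k (k + D - d1) (by omega)
  have hk : hc k β ∈ BI g r := ⟨s', hs', hs''⟩
  have h0 : phi p (s - C (eval p s / eval p (hc k β)) * hc k β) = 0 := by
    rw [map_sub, map_mul, phi_hom p hs, phi_hom p (hc_hom k β)]
    have : phi p (C (eval p s / eval p (hc k β))) = Polynomial.C (eval p s / eval p (hc k β)) := by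
      unfold phi; rw [aeval_C]; rfl
    rw [this, ← mul_assoc, ← Polynomial.C_mul, div_mul_cancel₀ _ he, sub_self]
  obtain ⟨x, y, hxy⟩ := (ker_phi a b p hp hp0 _).1 h0
  have : s = x * lin a + y * lin b + C (eval p s / eval p (hc k β)) * hc k β := by
    rw [← hxy]; ring
  rw [this]
  exact add_mem (add_mem (Ideal.mul_mem_left _ _ ha) (Ideal.mul_mem_left _ _ hb))
    (Ideal.mul_mem_left _ _ hk)


lemma lin_coeff (a : Fin 3 → ℂ) (i : Fin 3) : eval (Pi.single i 1) (lin a) = a i := by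
  rw [eval_lin]; simp [Pi.single_apply]

lemma lin_reg {a b : Fin 3 → ℂ}
    (hp0 : ![a 1 * b 2 - a 2 * b 1, a 2 * b 0 - a 0 * b 2, a 0 * b 1 - a 1 * b 0] ≠ 0) :
    lin a ≠ 0 ∧ ∀ c, lin a ∣ lin b * c → lin a ∣ c := by
  have h0 : lin a ≠ 0 := by
    intro h
    have : ∀ i, a i = 0 := fun i => by rw [← lin_coeff a i, h, map_zero]
    apply hp0
    funext i; fin_cases i <;> simp [this]
  refine ⟨h0, ?_⟩
  have hirr : Irreducible (lin a) := by
    apply irreducible_of_totalDegree_eq_one ((lin_hom a).totalDegree h0)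
    intro x hx
    rw [isUnit_iff_ne_zero]
    rintro rfl
    apply h0
    ext m
    rw [coeff_zero]; exact zero_dvd_iff.1 (hx m)
  intro c hc
  refine (hirr.prime.dvd_or_dvd hc).resolve_left ?_
  rintro ⟨k, hk⟩
  have hk0 : k.IsHomogeneous 0 := by
    apply hom_of_mul (lin_hom a) h0
    rw [mul_comm, ← hk]
    exact lin_hom b
  have hkC : k = C (coeff 0 k) := by
    rw [← totalDegree_eq_zero_iff_eq_C]
    exact Nat.le_zero.1 hk0.totalDegree_le
  have hb : ∀ i, b i = a i * coeff 0 k := by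
    intro i
    rw [← lin_coeff b, hk, map_mul, lin_coeff]
    conv_lhs => rw [hkC, eval_C]
  apply hp0
  funext i; fin_cases i <;> simp [hb] <;> ring

lemma cr_anti (r s : Fin 3 → S) (i : Fin 3) : cr s r i = - cr r s i := by
  fin_cases i <;> simp [cr] <;> ring

lemma cr_lin_left (r a b : Fin 3 → S) (x y : S) (i : Fin 3) :
    cr (fun j => x * a j + y * b j) r i = x * cr a r i + y * cr b r i := by
  fin_cases i <;> simp [cr] <;> ring

section
variable {g r r2 r3 : Fin 3 → S} {l l' v : S}

lemma rel3 (hg : CT g) (hct : CT r) (hl : l ≠ 0)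
    (h2 : ∀ i, cr r r2 i = l * g i) (h3 : ∀ i, cr r r3 i = l' * g i)
    (h23 : ∀ i, cr r2 r3 i = v * g i) (i : Fin 3) :
    l * r3 i + l' * (- r2 i) + v * r i = 0 := by
  obtain ⟨k, hk⟩ := mult_r hct (s := fun j => 1 * (l * r3 j + (-l') * r2 j) + v * r j) (fun i => by
    rw [cr_lin r (fun j => l * r3 j + (-l') * r2 j), cr_lin, cr_self, h2, h3]; ring)
  have hk0 : k = 0 := by
    apply CT_cancel (g := g) hg
    intro i
    have e1 : cr r2 (fun j => 1 * (l * r3 j + (-l') * r2 j) + v * r j) i = 0 := by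
      rw [cr_lin r2 (fun j => l * r3 j + (-l') * r2 j), cr_lin, cr_self, h23, cr_anti, h2]; ring
    have e2 : (fun j => 1 * (l * r3 j + (-l') * r2 j) + v * r j) = fun j => k * r j + 0 * r j := by
      funext j; rw [hk j]; ring
    rw [e2, cr_lin, cr_anti, h2] at e1
    apply (mul_eq_zero.1 (show l * (k * g i) = 0 by linear_combination -e1)).resolve_left hl
  have := hk i
  rw [hk0] at this
  linear_combination this

lemma gen3 (hg : CT g) (hct : CT r) (hrg : dt r g = 0)
    (h2 : ∀ i, cr r r2 i = l * g i) (h3 : ∀ i, cr r r3 i = l' * g i)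
    (hB : ∀ β, inB g r β → ∃ x y, β = x * l + y * l') (s : Fin 3 → S) (hs : dt s g = 0) :
    ∃ x y z, ∀ i, s i = x * r i + y * r2 i + z * r3 i := by
  obtain ⟨β, hβ⟩ := delta hg hrg hs
  obtain ⟨x, y, rfl⟩ := hB β ⟨s, hs, hβ⟩
  obtain ⟨k, hk⟩ := mult_r hct (s := fun j => 1 * s j + (-1) * (x * r2 j + y * r3 j)) (fun i => by
    rw [cr_lin r s (fun j => x * r2 j + y * r3 j), cr_lin, hβ, h2, h3]; ring)
  exact ⟨k, x, y, fun i => by linear_combination hk i⟩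

lemma v_not (hg : CT g) (hct : CT r) (hrg : dt r g = 0) (hr2 : dt r2 g = 0) (hl : l ≠ 0)
    (hl' : ∀ c, l ∣ l' * c → l ∣ c)
    (h2 : ∀ i, cr r r2 i = l * g i) (h3 : ∀ i, cr r r3 i = l' * g i)
    (h23 : ∀ i, cr r2 r3 i = v * g i) (h1 : ¬ inB g r 1) (x y : S) : v ≠ x * l + y * l' := by
  rintro rfl
  apply h1
  have e2 : ∀ i, cr r (fun j => 1 * r2 j + (-y) * r j) i = l * g i := fun i => by
    rw [cr_lin, cr_self, h2]; ring
  have e3 : ∀ i, cr r (fun j => 1 * r3 j + x * r j) i = l' * g i := fun i => by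
    rw [cr_lin, cr_self, h3]; ring
  have e23 : ∀ i, cr (fun j => 1 * r2 j + (-y) * r j) (fun j => 1 * r3 j + x * r j) i = 0 * g i := by
    intro i
    rw [cr_lin_left, cr_lin, cr_lin, h23, cr_self, h3, cr_anti, h2]; ring
  have hrel := rel3 hg hct hl e2 e3 e23
  choose s hs using fun i => hl' (1 * r2 i + (-y) * r i) ⟨1 * r3 i + x * r i, by linear_combination -hrel i⟩
  have hs' : (fun j => 1 * r2 j + (-y) * r j) = fun j => l * s j + 0 * s j := by
    funext j; rw [hs]; ring
  refine ⟨s, ?_, fun i => ?_⟩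
  · have := dt_lin g r2 r 1 (-y)
    rw [hs', dt_lin, hr2, hrg] at this
    exact (mul_eq_zero.1 (show l * dt s g = 0 by linear_combination this)).resolve_left hl
  · have := e2 i
    rw [hs', cr_lin] at this
    apply mul_left_cancel₀ hl
    linear_combination this

lemma bigstruct (hg : CT g) (hct : CT r) (hrg : dt r g = 0) (hr2 : dt r2 g = 0) (hr3 : dt r3 g = 0)
    (hl : l ≠ 0) (hv : v ≠ 0)
    (hl' : ∀ c, l ∣ l' * c → l ∣ c)
    (h2 : ∀ i, cr r r2 i = l * g i) (h3 : ∀ i, cr r r3 i = l' * g i)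
    (h23 : ∀ i, cr r2 r3 i = v * g i)
    (hB : ∀ β, inB g r β → ∃ x y, β = x * l + y * l')
    (hvr : ∀ a, (∃ x y, v * a = x * l + y * l') → ∃ x y, a = x * l + y * l') :
    ∃ h : S, (∀ w, (∃ η, dt η g = w * h) ↔ ∃ x y z, w = x * l + y * l' + z * v) ∧
      ∀ q, (∀ i, ∃ A : (Fin 3 → S) × S, dt A.1 g + A.2 * h = X i * q) →
        ∃ A : (Fin 3 → S) × S, dt A.1 g + A.2 * h = q := by
  obtain ⟨x, y, z, hxyz⟩ := K2v hl hl' hvr r3 (fun i => - r2 i) r (rel3 hg hct hl h2 h3 h23)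
  have E3 : r3 = fun j => (-v) * x j + (-l') * z j := by
    funext j; rw [(hxyz j).1]; ring
  have E2 : r2 = fun j => v * y j + (-l) * z j := by
    funext j; linear_combination -(hxyz j).2.1
  have E1 : r = fun j => l * x j + l' * y j := by
    funext j; rw [(hxyz j).2.2]
  have q1 := hrg
  have q2 := hr2
  have q3 := hr3
  rw [E1, dt_lin] at q1
  rw [E2, dt_lin] at q2
  rw [E3, dt_lin] at q3
  obtain ⟨h, hy⟩ := hl' (dt y g) ⟨- dt x g, by linear_combination q1⟩
  have hx : dt x g = - (l' * h) := by
    apply mul_left_cancel₀ hl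
    rw [hy] at q1; linear_combination q1
  have hz : dt z g = v * h := by
    apply mul_left_cancel₀ hl
    rw [hy] at q2; linear_combination -q2
  have colon : ∀ w, (∃ η, dt η g = w * h) → ∃ x y z, w = x * l + y * l' + z * v := by
    rintro w ⟨α, hα⟩
    have d1 : dt (fun j => l * α j + (-w) * y j) g = 0 := by
      rw [dt_lin, hα, hy]; ring
    have d2 : dt (fun j => l' * α j + w * x j) g = 0 := by
      rw [dt_lin, hα, hx]; ring
    obtain ⟨k, hk⟩ := delta hg hr2 d1
    obtain ⟨a1, a2, a3, ha⟩ := gen3 hg hct hrg h2 h3 hB _ d2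
    have e : ∀ i, cr r2 (fun j => l' * α j + w * x j) i = (- a1 * l + a3 * v) * g i := by
      intro i
      have : (fun j => l' * α j + w * x j) = fun j => 1 * (a1 * r j + a2 * r2 j) + a3 * r3 j := by
        funext j; rw [ha j]; ring
      rw [this, cr_lin r2 (fun j => a1 * r j + a2 * r2 j), cr_lin, cr_anti, h2, cr_self, h23]
      ring
    have e0 : l' * k - l * (- a1 * l + a3 * v) - w * l = 0 := by
      apply CT_cancel hg
      intro i
      have t1 := cr_lin r2 (fun j => l * α j + (-w) * y j) (fun j => l' * α j + w * x j) l' (-l) i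
      have t2 : (fun j => l' * (l * α j + (-w) * y j) + (-l) * (l' * α j + w * x j)) =
        fun j => (-w) * r j + 0 * r j := by
        funext j; rw [(hxyz j).2.2]; ring
      rw [t2, cr_lin, cr_anti, h2, hk, e] at t1
      linear_combination -t1
    obtain ⟨m, hm⟩ := hl' k ⟨(- a1 * l + a3 * v) + w, by linear_combination e0⟩
    refine ⟨a1, m, -a3, ?_⟩
    apply mul_left_cancel₀ hl
    rw [hm] at e0
    linear_combination -e0
  refine ⟨h, fun w => ⟨colon w, ?_⟩, ?_⟩
  · rintro ⟨a1, a2, a3, rfl⟩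
    refine ⟨fun j => 1 * (a1 * y j + (-a2) * x j) + a3 * z j, ?_⟩
    rw [dt_lin g (fun j => a1 * y j + (-a2) * x j), dt_lin, hx, hy, hz]; ring
  · intro q hq
    let φ : (Fin 3 → S) × S →ₗ[S] S :=
      { toFun := fun A => dt A.1 g + A.2 * h
        map_add' := fun a b => by simp [dt]; ring
        map_smul' := fun a b => by simp [dt]; ring }
    let ψ : (Fin 3 → S) →ₗ[S] (Fin 3 → S) × S :=
      { toFun := fun a => (fun j => 1 * (a 0 * y j + (-a 1) * x j) + a 2 * z j,
          - (a 0 * l + a 1 * l' + a 2 * v))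
        map_add' := fun a b => by
          ext1
          · funext j; simp; ring
          · simp; ring
        map_smul' := fun a b => by
          ext1
          · funext j; simp; ring
          · simp; ring }
    have hφ : ∀ A, φ A = dt A.1 g + A.2 * h := fun A => rfl
    have hψ1 : ∀ a, (ψ a).1 = fun j => 1 * (a 0 * y j + (-a 1) * x j) + a 2 * z j := fun a => rfl
    have hψ2 : ∀ a, (ψ a).2 = - (a 0 * l + a 1 * l' + a 2 * v) := fun a => rfl
    have hdψ : ∀ a, dt (ψ a).1 g = (a 0 * l + a 1 * l' + a 2 * v) * h := by
      intro a
      rw [hψ1, dt_lin g (fun j => a 0 * y j + (-a 1) * x j), dt_lin, hx, hy, hz]; ring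
    refine sat (D2_prod D2_pi D2_self) φ ψ ?_ ?_ ?_ q hq
    · intro a ha
      have z1 : ∀ j, a 0 * y j + (-a 1) * x j + a 2 * z j = 0 := by
        intro j
        have := congrFun (congrArg Prod.fst ha) j
        rw [hψ1] at this
        simp only [one_mul, Prod.fst_zero, Pi.zero_apply] at this
        exact this
      have z2 : a 0 * l + a 1 * l' + a 2 * v = 0 := by
        have := congrArg Prod.snd ha
        rw [hψ2] at this
        exact neg_eq_zero.1 this
      have y1 : ∀ j, a 0 * r2 j + a 1 * r3 j = 0 := by
        intro j
        rw [E2, E3]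
        linear_combination v * z1 j - z j * z2
      have y2 : ∀ j, a 1 * r j + a 2 * r2 j = 0 := by
        intro j
        rw [E2, E1]
        linear_combination y j * z2 - l * z1 j
      have cz : ∀ (s : Fin 3 → S) (i : Fin 3), cr s (fun _ => 0) i = 0 := by
        intro s i; fin_cases i <;> simp [cr]
      have ha1 : a 1 = 0 := by
        apply CT_cancel hg
        intro i
        have := cr_lin r2 r2 r3 (a 0) (a 1) i
        rw [funext y1, cz, cr_self, h23] at this
        exact (mul_eq_zero.1 (show v * (a 1 * g i) = 0 by linear_combination -this)).resolve_left hv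
      have ha0 : a 0 = 0 := by
        apply CT_cancel hg
        intro i
        have := cr_lin r3 r2 r3 (a 0) (a 1) i
        rw [funext y1, cz, cr_self, cr_anti, h23] at this
        exact (mul_eq_zero.1 (show v * (a 0 * g i) = 0 by linear_combination this)).resolve_left hv
      have ha2 : a 2 = 0 := by
        rw [ha0, ha1] at z2
        exact (mul_eq_zero.1 (show a 2 * v = 0 by linear_combination z2)).resolve_right hv
      funext i; fin_cases i
      · exact ha0
      · exact ha1
      · exact ha2
    · intro a
      rw [hφ, hdψ, hψ2]; ring
    · rintro ⟨α, w⟩ hA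
      rw [hφ] at hA
      simp only at hA
      obtain ⟨b1, b2, b3, hb⟩ := colon (-w) ⟨α, by linear_combination hA⟩
      have hw : w = -(b1 * l + b2 * l' + b3 * v) := by linear_combination -hb
      have hd : dt (fun j => 1 * α j + (-1) * (ψ ![b1, b2, b3]).1 j) g = 0 := by
        rw [dt_lin g α (fun j => (ψ ![b1, b2, b3]).1 j)]
        change _ + _ * dt (ψ ![b1, b2, b3]).1 g = 0
        rw [hdψ]
        simp
        rw [hw] at hA
        linear_combination hA
      obtain ⟨k1, k2, k3, hk⟩ := gen3 hg hct hrg h2 h3 hB _ hd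
      refine ⟨![b1 + k1 * l' + k2 * v, b2 - k1 * l + k3 * v, b3 - k2 * l - k3 * l'], ?_⟩
      ext1
      · rw [hψ1]
        funext j
        have := hk j
        rw [hψ1, E1, E2, E3] at this
        simp at this ⊢
        linear_combination -this
      · rw [hψ2, hw]
        simp
        ring
end


lemma phi_surj {p : Fin 3 → ℂ} (hp0 : p ≠ 0) : Function.Surjective (phi p) := by
  obtain ⟨i, hi⟩ := Function.ne_iff.1 hp0
  simp only [Pi.zero_apply] at hi
  intro q
  refine ⟨Polynomial.aeval (C (p i)⁻¹ * X i : S) q, ?_⟩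
  rw [← Polynomial.aeval_algHom_apply]
  have : phi p (C (p i)⁻¹ * X i) = Polynomial.X := by
    rw [map_mul]
    unfold phi
    rw [aeval_C, aeval_X]
    change Polynomial.C _ * _ = _
    rw [← mul_assoc, ← Polynomial.C_mul, inv_mul_cancel₀ hi]; simp
  rw [this, Polynomial.aeval_X_left_apply]

lemma ndimTot_of {f h : S} {n : ℕ} {p : Fin 3 → ℂ} (hp0 : p ≠ 0)
    (hI : ∀ q, q ∈ Isat f ↔ ∃ a, q - a * h ∈ Jf f)
    (hJ : ∀ a, a * h ∈ Jf f ↔ Polynomial.X ^ n ∣ phi p a) : ndimTot f = n := by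
  let L : S →ₗ[ℂ] (S ⧸ (Jf f : Submodule S S)) := (quotC f).comp (LinearMap.mulRight ℂ h)
  let Q : Ideal (Polynomial ℂ) := Ideal.span {Polynomial.X ^ n}
  let M : S →ₗ[ℂ] (Polynomial ℂ ⧸ Q) := (Ideal.Quotient.mkₐ ℂ Q).toLinearMap.comp (phi p).toLinearMap
  have hq : ∀ x, quotC f x = 0 ↔ x ∈ Jf f := fun x => Submodule.Quotient.mk_eq_zero _
  have hr : NsubTot f = LinearMap.range L := by
    apply le_antisymm
    · rintro _ ⟨q, hqI, rfl⟩
      obtain ⟨a, ha⟩ := (hI q).1 hqI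
      refine ⟨a, ?_⟩
      have := (hq _).2 ha
      rw [map_sub, sub_eq_zero] at this
      exact this.symm
    · rintro _ ⟨a, rfl⟩
      exact ⟨a * h, (hI _).2 ⟨a, by simp⟩, rfl⟩
  have hk : LinearMap.ker L = LinearMap.ker M := by
    ext a
    rw [LinearMap.mem_ker, LinearMap.mem_ker]
    change quotC f (a * h) = 0 ↔ Ideal.Quotient.mk Q (phi p a) = 0
    rw [hq, hJ, Ideal.Quotient.eq_zero_iff_mem, Ideal.mem_span_singleton]
  have hM : LinearMap.range M = ⊤ := by
    rw [LinearMap.range_eq_top]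
    exact (Ideal.Quotient.mk_surjective).comp (phi_surj hp0)
  unfold ndimTot
  rw [hr, ← L.quotKerEquivRange.finrank_eq, hk, M.quotKerEquivRange.finrank_eq, hM, finrank_top]
  rw [finrank_quotient_span_eq_natDegree, Polynomial.natDegree_X_pow]

lemma ndimTot_val (f : S) (d : ℕ) (hhom : f.IsHomogeneous d) (hred : Squarefree f)
    (hnf : NearlyFree f) (d1 : ℕ) (h2 : 2 * d1 ≤ d) (hd1 : IsLeast (mdrSet f) d1) :
    ndimTot f = d + 1 - 2 * d1 := by
  have hd := deg_pos hhom hnf.1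
  have hgc := CT_gr hhom hd hred
  have hg := gr_hom hhom
  obtain ⟨r, hrA, hr0, hr⟩ := hd1.1
  replace hr : ∀ i, (r i).IsHomogeneous d1 := hr
  have hrg := mem_AR.1 hrA
  have hct := CT_r hhom hd1 hrg hr0 hr
  have h1 : ¬ inB (gr f) r 1 := by
    apply one_notMem hgc hct hrg
    intro hs
    apply Nmod_ne hnf.1
    intro q hq
    exact mem_Jf.2 (hs q fun i => mem_Jf.1 (hq i))
  have hd1' : 1 ≤ d1 := by
    by_contra hz
    obtain rfl : d1 = 0 := by omega
    obtain ⟨i, hi⟩ := CT_ne hct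
    have hC : r i = C (coeff 0 (r i)) := by
      rw [← totalDegree_eq_zero_iff_eq_C]
      exact Nat.le_zero.1 (hr i).totalDegree_le
    have hne : coeff 0 (r i) ≠ 0 := by
      intro h0; rw [h0, map_zero] at hC; exact hi hC
    apply h1
    have := Ideal.mul_mem_left (BI (gr f) r) (C (coeff 0 (r i))⁻¹) (r_mem_BI hrg i)
    rw [hC, coeff_C, if_pos rfl, ← C_mul, inv_mul_cancel₀ hne, C_1] at this
    exact this
  obtain ⟨a, b, hp0, ha, hb⟩ := two_lin hhom hd hgc hrg hr hct h2 hd1' hnf.2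
  obtain ⟨p, hp⟩ : ∃ p, p = ![a 1 * b 2 - a 2 * b 1, a 2 * b 0 - a 0 * b 2,
    a 0 * b 1 - a 1 * b 0] := ⟨_, rfl⟩
  obtain ⟨hl, hl'⟩ := lin_reg hp0
  rw [← hp] at hp0
  have hker := ker_phi a b p hp hp0
  have hB : ∀ β, inB (gr f) r β → ∃ x y, β = x * lin a + y * lin b := fun β hβ =>
    (hker β).1 (B_le hgc hct hrg hg hr (by omega) h1 hp hp0 ha hb hβ)
  obtain ⟨r2, hr2h, hr2, h2'⟩ := BI_hom hg hr ha 1 (d - d1) (by omega)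
  obtain ⟨r3, hr3h, hr3, h3'⟩ := BI_hom hg hr hb 1 (d - d1) (by omega)
  rw [hc_self (lin_hom _)] at h2' h3'
  obtain ⟨v, hv⟩ := delta hgc hr2 hr3
  obtain ⟨n, hn⟩ : ∃ n, n = d + 1 - 2 * d1 := ⟨_, rfl⟩
  have hvh : v.IsHomogeneous n := by
    obtain ⟨i, hi⟩ := CT_ne hgc
    apply hom_of_mul (hg i) hi
    rw [← hv]
    have e : n + (d - 1) = (d - d1) + (d - d1) := by omega
    rw [e]
    fin_cases i
    · exact ((hr2h 1).mul (hr3h 2)).sub ((hr2h 2).mul (hr3h 1))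
    · exact ((hr2h 2).mul (hr3h 0)).sub ((hr2h 0).mul (hr3h 2))
    · exact ((hr2h 0).mul (hr3h 1)).sub ((hr2h 1).mul (hr3h 0))
  have hphiv : phi p v ≠ 0 := by
    intro h0
    obtain ⟨x, y, hxy⟩ := (hker v).1 h0
    exact v_not hgc hct hrg hr2 hl hl' h2' h3' hv h1 x y hxy
  have hv0 : v ≠ 0 := by rintro rfl; exact hphiv (map_zero _)
  have hev : eval p v ≠ 0 := by
    intro h0; apply hphiv; rw [phi_hom p hvh, h0]; simp
  have hvr : ∀ c, (∃ x y, v * c = x * lin a + y * lin b) → ∃ x y, c = x * lin a + y * lin b := by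
    intro c hc
    rw [← hker] at hc ⊢
    rw [map_mul] at hc
    exact (mul_eq_zero.1 hc).resolve_left hphiv
  obtain ⟨h, hcol, hsat⟩ := bigstruct hgc hct hrg hr2 hr3 hl hv0 hl' h2' h3' hv hB hvr
  have hJ : ∀ c, c * h ∈ Jf f ↔ Polynomial.X ^ n ∣ phi p c := by
    intro c
    rw [mem_Jf, hcol]
    constructor
    · rintro ⟨x, y, z, rfl⟩
      rw [map_add, (hker _).2 ⟨x, y, rfl⟩, map_mul, phi_hom p hvh, zero_add]
      exact ⟨phi p z * Polynomial.C (eval p v), by ring⟩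
    · rintro ⟨q, hq⟩
      obtain ⟨z, hz⟩ := phi_surj hp0 (Polynomial.C (eval p v)⁻¹ * q)
      have : phi p (c - z * v) = 0 := by
        rw [map_sub, map_mul, hz, hq, phi_hom p hvh, sub_eq_zero]
        have : Polynomial.C (eval p v)⁻¹ * q * (Polynomial.C (eval p v) * Polynomial.X ^ n) =
          Polynomial.C ((eval p v)⁻¹ * eval p v) * (Polynomial.X ^ n * q) := by
          rw [Polynomial.C_mul]; ring
        rw [this, inv_mul_cancel₀ hev]; simp
      obtain ⟨x, y, hxy⟩ := (hker _).1 this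
      exact ⟨x, y, z, by rw [← hxy]; ring⟩
  have hhI : h ∈ Isat f := by
    refine desc (Isat f) (fun q => Isat_step) h n ?_
    intro s hs
    apply Jf_le_Isat
    rw [hJ, phi_hom p hs]
    exact ⟨Polynomial.C (eval p s), by ring⟩
  have hI : ∀ q, q ∈ Isat f ↔ ∃ c, q - c * h ∈ Jf f := by
    intro q
    constructor
    · intro hq
      have hle : Isat f ≤ Jf f ⊔ Ideal.span {h} := by
        have hm : ∀ x, x ∈ Jf f ⊔ Ideal.span {h} ↔ ∃ A : (Fin 3 → S) × S,
            dt A.1 (gr f) + A.2 * h = x := by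
          intro x
          constructor
          · intro hx
            obtain ⟨i, hi, j, hj, rfl⟩ := Submodule.mem_sup.1 hx
            obtain ⟨c, rfl⟩ := Ideal.mem_span_singleton'.1 hj
            obtain ⟨η, rfl⟩ := mem_Jf.1 hi
            exact ⟨(η, c), rfl⟩
          · rintro ⟨A, rfl⟩
            exact add_mem (Ideal.mem_sup_left (mem_Jf.2 ⟨_, rfl⟩))
              (Ideal.mem_sup_right (Ideal.mem_span_singleton'.2 ⟨_, rfl⟩))
        refine Isat_le le_sup_left ?_
        intro x hx
        rw [hm]
        exact hsat x fun i => (hm _).1 (hx i)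
      obtain ⟨i, hi, j, hj, rfl⟩ := Submodule.mem_sup.1 (hle hq)
      obtain ⟨c, rfl⟩ := Ideal.mem_span_singleton'.1 hj
      exact ⟨c, by simpa using hi⟩
    · rintro ⟨c, hc⟩
      have : q = (q - c * h) + c * h := by ring
      rw [this]
      exact add_mem (Jf_le_Isat f hc) (Ideal.mul_mem_left _ _ hhI)
  rw [ndimTot_of hp0 hI hJ, hn]

theorem stmt5 (f : S) (d : ℕ) (hhom : f.IsHomogeneous d) (hred : Squarefree f)
    (hnc : ¬ IsConeOfLines f) (hnf : NearlyFree f) (d1 d2 : ℕ)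
    (h12 : d1 ≤ d2) (hsum : d1 + d2 = d) (hd1 : IsLeast (mdrSet f) d1) :
    ((Even d → ndimTot f = 1) ∧ (¬ Even d → ndimTot f = 2)) ↔
      ((Even d → d2 = d1) ∧ (¬ Even d → d2 = d1 + 1)) := by
  rw [ndimTot_val f d hhom hred hnf d1 (by omega) hd1]
  rw [Nat.even_iff]
  omega


end
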